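/- arXiv:1302.5984 — 2 statements merged into one kernel-verified Lean document; each statement's English description precedes it below -/
import Mathlib

section
/- The series ∑_{n=0}^∞ C(2n,n)² · P_n(1/3) · (−1/36)^n · (1 − 3n − 84n² − 121n³) converges to 18√3/π. -/
open Real Filter

/-- The Legendre polynomial of degree `n`, given by the explicit formula
`P_n(x) = 2^{-n} ∑_{j=0}^{n} C(n,j)^2 (x-1)^{n-j} (x+1)^j`. -/
noncomputable def legendreP (n : ℕ) (x : ℝ) : ℝ :=
  (2 : ℝ)⁻¹ ^ n *
    ∑ j ∈ Finset.range (n + 1), (n.choose j : ℝ) ^ 2 * (x - 1) ^ (n - j) * (x + 1) ^ j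

section PowerSeries

/-- The sum of the power series with coefficients `u`. -/
noncomputable def powerSum (u : ℕ → ℝ) (x : ℝ) : ℝ := ∑' n, u n * x ^ n

/-- The radius of convergence of the power series with coefficients `u` is at least `r`. -/
def RadiusGE (u : ℕ → ℝ) (r : ℝ) : Prop :=
  ∀ s, 0 ≤ s → s < r → ∃ C, ∀ n, |u n| * s ^ n ≤ C

/-- The coefficients of the termwise derivative. -/
def derivCoeff (u : ℕ → ℝ) (n : ℕ) : ℝ := (n + 1) * u (n + 1)

/-- The coefficients of the image under the Euler operator `x d/dx`. -/
def eulerCoeff (u : ℕ → ℝ) (n : ℕ) : ℝ := n * u n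

theorem RadiusGE.summable_abs {u : ℕ → ℝ} {r x : ℝ} (hu : RadiusGE u r) (hx : |x| < r) :
    Summable fun n => |u n * x ^ n| := by
  obtain ⟨s, hs1, hs2⟩ := exists_between hx
  have hs0 : 0 < s := (abs_nonneg x).trans_lt hs1
  obtain ⟨C, hC⟩ := hu s hs0.le hs2
  have hq : |x| / s < 1 := (div_lt_one hs0).2 hs1
  refine Summable.of_nonneg_of_le (fun n => abs_nonneg _) (fun n => ?_)
    ((summable_geometric_of_lt_one (by positivity) hq).mul_left C)
  have : |u n * x ^ n| = |u n| * s ^ n * (|x| / s) ^ n := by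
    rw [abs_mul, abs_pow, div_pow]; field_simp
  rw [this]
  exact mul_le_mul_of_nonneg_right (hC n) (by positivity)

theorem RadiusGE.summable {u : ℕ → ℝ} {r x : ℝ} (hu : RadiusGE u r) (hx : |x| < r) :
    Summable fun n => u n * x ^ n :=
  (hu.summable_abs hx).of_abs

theorem RadiusGE.euler {u : ℕ → ℝ} {r : ℝ} (hu : RadiusGE u r) : RadiusGE (eulerCoeff u) r := by
  intro s hs0 hs
  obtain ⟨t, ht1, ht2⟩ := exists_between hs
  have ht0 : 0 < t := hs0.trans_lt ht1
  obtain ⟨C, hC⟩ := hu t ht0.le ht2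
  have hq : ‖s / t‖ < 1 := by
    rw [Real.norm_of_nonneg (by positivity)]; exact (div_lt_one ht0).2 ht1
  have hsum := summable_pow_mul_geometric_of_norm_lt_one 1 hq
  obtain ⟨D, hD⟩ := hsum.tendsto_atTop_zero.bddAbove_range
  have hC0 : 0 ≤ C := le_trans (by positivity) (hC 0)
  refine ⟨C * D, fun n => ?_⟩
  have h1 : |eulerCoeff u n| * s ^ n = (|u n| * t ^ n) * ((n : ℝ) ^ 1 * (s / t) ^ n) := by
    rw [eulerCoeff, abs_mul, div_pow, Nat.abs_cast]; field_simp
  rw [h1]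
  exact mul_le_mul (hC n) (hD ⟨n, rfl⟩) (by positivity) hC0

theorem RadiusGE.deriv {u : ℕ → ℝ} {r : ℝ} (hu : RadiusGE u r) : RadiusGE (derivCoeff u) r := by
  intro s hs0 hs
  rcases hs0.eq_or_lt with rfl | hs0
  · refine ⟨|derivCoeff u 0|, fun n => ?_⟩
    rcases n with _ | n <;> simp
  obtain ⟨C, hC⟩ := hu.euler s hs0.le hs
  refine ⟨C / s, fun n => ?_⟩
  rw [le_div_iff₀ hs0]
  have := hC (n + 1)
  simp only [eulerCoeff, Nat.cast_add, Nat.cast_one] at this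
  rwa [derivCoeff, mul_assoc, ← pow_succ]

theorem powerSum_eulerCoeff {u : ℕ → ℝ} {r x : ℝ} (hu : RadiusGE u r) (hx : |x| < r) :
    powerSum (eulerCoeff u) x = x * powerSum (derivCoeff u) x := by
  rw [powerSum, (hu.euler.summable hx).tsum_eq_zero_add, powerSum, ← tsum_mul_left]
  simp only [eulerCoeff, derivCoeff, Nat.cast_zero, zero_mul, zero_add]
  refine tsum_congr fun n => ?_
  push_cast; ring

theorem RadiusGE.hasDerivAt {u : ℕ → ℝ} {r x : ℝ} (hu : RadiusGE u r) (hx : |x| < r) :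
    HasDerivAt (powerSum u) (powerSum (derivCoeff u) x) x := by
  obtain ⟨s, hs1, hs2⟩ := exists_between hx
  have hs0 : 0 < s := (abs_nonneg x).trans_lt hs1
  have hs : |s| < r := by rwa [abs_of_pos hs0]
  have hsum : Summable fun n : ℕ => |u n| * (n * s ^ (n - 1)) := by
    rw [← summable_nat_add_iff 1]
    refine (hu.deriv.summable_abs hs).congr fun n => ?_
    rw [derivCoeff, abs_mul, abs_mul, abs_pow, abs_of_pos hs0, abs_of_nonneg (by positivity)]
    push_cast [Nat.add_sub_cancel]; ring
  have hmem : ∀ y ∈ Metric.ball (0 : ℝ) s, |y| < s := fun y hy => by simpa using hy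
  have key := hasDerivAt_tsum_of_isPreconnected (g := fun n y => u n * y ^ n)
    (g' := fun n y => u n * (n * y ^ (n - 1))) hsum Metric.isOpen_ball
    (convex_ball (0 : ℝ) s).isPreconnected (y := x)
    (fun n y _ => (hasDerivAt_pow n y).const_mul (u n))
    (fun n y hy => by
      rw [norm_mul, norm_mul, norm_pow, Real.norm_natCast, Real.norm_eq_abs, Real.norm_eq_abs]
      have := (hmem y hy).le
      gcongr)
    (Metric.mem_ball_self hs0) (hu.summable (by simpa using hs0.trans hs2)) (by simpa using hs1)
  convert! key using 1
  have hsum' : Summable fun n : ℕ => u n * (n * x ^ (n - 1)) := by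
    rw [← summable_nat_add_iff 1]
    refine (hu.deriv.summable hx).congr fun n => ?_
    rw [derivCoeff]; push_cast [Nat.add_sub_cancel]; ring
  rw [hsum'.tsum_eq_zero_add, powerSum]
  simp only [Nat.cast_zero, zero_mul, mul_zero, zero_add]
  refine tsum_congr fun n => ?_
  rw [derivCoeff]; push_cast [Nat.add_sub_cancel]; ring

theorem powerSum_zero (u : ℕ → ℝ) : powerSum u 0 = u 0 := by
  rw [powerSum, tsum_eq_single 0 (fun n hn => by simp [hn])]; simp

/-- Abel summation: if the coefficients tend to `l`, then `(1 - x)` times the sum of the power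
series tends to `l` as `x → 1⁻`. -/
theorem tendsto_one_sub_mul_powerSum {u : ℕ → ℝ} {l : ℝ} (hr : RadiusGE u 1)
    (hu : Tendsto u atTop (nhds l)) :
    Tendsto (fun x => (1 - x) * powerSum u x) (nhdsWithin 1 (Set.Iio 1)) (nhds l) := by
  let f : ℕ → ℝ := fun n => u n - if n = 0 then 0 else u (n - 1)
  have hf : ∀ n, ∑ i ∈ Finset.range (n + 1), f i = u n := by
    intro n
    induction n with
    | zero => simp [f]
    | succ n ih => rw [Finset.sum_range_succ, ih]; simp [f]
  have hlim : Tendsto (fun n => ∑ i ∈ Finset.range n, f i) atTop (nhds l) := by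
    rw [← tendsto_add_atTop_iff_nat 1]
    simpa only [hf] using hu
  refine (Real.tendsto_tsum_powerSeries_nhdsWithin_lt hlim).congr' ?_
  filter_upwards [Ioo_mem_nhdsLT (zero_lt_one' ℝ)] with x hx
  have hx1 : |x| < 1 := by rw [abs_of_pos hx.1]; exact hx.2
  have hs := hr.summable hx1
  have hs2 : Summable fun n => (if n = 0 then 0 else u (n - 1)) * x ^ n := by
    rw [← summable_nat_add_iff 1]
    refine (hs.mul_left x).congr fun n => ?_
    simp; ring
  have : ∑' n, (if n = 0 then 0 else u (n - 1)) * x ^ n = x * powerSum u x := by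
    rw [hs2.tsum_eq_zero_add, powerSum, ← tsum_mul_left]
    simp only [if_true, zero_mul, zero_add]
    refine tsum_congr fun n => ?_
    simp; ring
  simp only [f, sub_mul]
  rw [hs.tsum_sub hs2, this, powerSum]
  ring

end PowerSeries

section EllipticSeries

/-- The coefficients `(1/2)_n² / n!²` of the hypergeometric series `₂F₁(1/2, 1/2; 1; x)`. -/
noncomputable def ellCoeff (n : ℕ) : ℝ := ((2 * n).choose n : ℝ) ^ 2 / 16 ^ n

/-- The hypergeometric function `₂F₁(1/2, 1/2; 1; x)`. -/
noncomputable def ellF (x : ℝ) : ℝ := powerSum ellCoeff x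

/-- The derivative of `ellF`. -/
noncomputable def ellF' (x : ℝ) : ℝ := powerSum (derivCoeff ellCoeff) x

theorem ellCoeff_zero : ellCoeff 0 = 1 := by simp [ellCoeff]

theorem ellCoeff_pos (n : ℕ) : 0 < ellCoeff n := by
  have := Nat.choose_pos (show n ≤ 2 * n by omega)
  unfold ellCoeff; positivity

theorem ellCoeff_succ (n : ℕ) :
    ((n : ℝ) + 1) ^ 2 * ellCoeff (n + 1) = (n + 1 / 2) ^ 2 * ellCoeff n := by
  have h := Nat.succ_mul_centralBinom_succ n
  rw [Nat.centralBinom_eq_two_mul_choose, Nat.centralBinom_eq_two_mul_choose] at h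
  have h' : ((n : ℝ) + 1) * ((2 * (n + 1)).choose (n + 1) : ℝ)
      = 2 * (2 * n + 1) * ((2 * n).choose n : ℝ) := by exact_mod_cast h
  rw [ellCoeff, ellCoeff, pow_succ]
  field_simp
  rw [← mul_pow, h']
  ring

theorem ellCoeff_le_one (n : ℕ) : ellCoeff n ≤ 1 := by
  induction n with
  | zero => rw [ellCoeff_zero]
  | succ n ih =>
    have h := ellCoeff_succ n
    have := ellCoeff_pos n
    have hn : (0 : ℝ) ≤ n := n.cast_nonneg
    by_contra! hlt
    nlinarith

theorem radiusGE_of_abs_le {u : ℕ → ℝ} {c : ℝ} (hc : 0 < c) (hu : ∀ n, |u n| ≤ c ^ n) :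
    RadiusGE u c⁻¹ := by
  intro s hs0 hs
  refine ⟨1, fun n => ?_⟩
  have h1 : c * s ≤ 1 := by
    rw [← mul_inv_cancel₀ hc.ne']; exact mul_le_mul_of_nonneg_left hs.le hc.le
  calc |u n| * s ^ n ≤ c ^ n * s ^ n := by gcongr; exact hu n
    _ = (c * s) ^ n := (mul_pow _ _ _).symm
    _ ≤ 1 := pow_le_one₀ (by positivity) h1

theorem radiusGE_ellCoeff : RadiusGE ellCoeff 1 := by
  have := radiusGE_of_abs_le (u := ellCoeff) (c := 1) one_pos fun n => by
    rw [abs_of_pos (ellCoeff_pos n), one_pow]; exact ellCoeff_le_one n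
  simpa using this

theorem hasDerivAt_ellF {x : ℝ} (hx : |x| < 1) : HasDerivAt ellF (ellF' x) x :=
  radiusGE_ellCoeff.hasDerivAt hx

/-- The hypergeometric differential equation: `x (1 - x) F'` has derivative `F / 4`. -/
theorem hasDerivAt_mul_ellF' {x : ℝ} (hx : |x| < 1) :
    HasDerivAt (fun y => y * (1 - y) * ellF' y) (ellF x / 4) x := by
  have hr := radiusGE_ellCoeff
  have h1 : HasDerivAt (fun y => (1 - y) * powerSum (eulerCoeff ellCoeff) y) _ x :=
    ((hasDerivAt_id x).const_sub 1).mul (hr.euler.hasDerivAt hx)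
  have h2 : powerSum (derivCoeff (eulerCoeff ellCoeff)) x
      = powerSum (eulerCoeff (eulerCoeff ellCoeff)) x + powerSum (eulerCoeff ellCoeff) x
        + ellF x / 4 := by
    have e : ellF x / 4 = ∑' n, ellCoeff n * x ^ n / 4 := by rw [ellF, powerSum, tsum_div_const]
    rw [e]
    simp only [powerSum]
    rw [← (hr.euler.euler.summable hx).tsum_add (hr.euler.summable hx),
      ← ((hr.euler.euler.summable hx).add (hr.euler.summable hx)).tsum_add
        ((hr.summable hx).div_const 4)]
    refine tsum_congr fun n => ?_
    simp only [derivCoeff, eulerCoeff]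
    push_cast
    linear_combination x ^ n * ellCoeff_succ n
  have h3 := powerSum_eulerCoeff hr.euler hx
  have h4 := powerSum_eulerCoeff hr hx
  have h5 : HasDerivAt (fun y => (1 - y) * powerSum (eulerCoeff ellCoeff) y) (ellF x / 4) x := by
    convert! h1 using 1
    simp only [id]
    linear_combination -h3 - h2
  refine h5.congr_of_eventuallyEq ?_
  have : ∀ᶠ y in nhds x, |y| < 1 := (continuous_abs.tendsto x).eventually_lt_const hx
  filter_upwards [this] with y hy
  rw [powerSum_eulerCoeff hr hy, ellF']
  ring

theorem ellF_zero : ellF 0 = 1 := by rw [ellF, powerSum_zero, ellCoeff_zero]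

theorem one_le_ellF {x : ℝ} (h0 : 0 ≤ x) (h1 : x < 1) : 1 ≤ ellF x := by
  have hx : |x| < 1 := by rwa [abs_of_nonneg h0]
  have := (radiusGE_ellCoeff.summable hx).le_tsum 0
    fun n _ => mul_nonneg (ellCoeff_pos n).le (pow_nonneg h0 n)
  simpa [ellCoeff_zero, ellF, powerSum] using this

theorem ellCoeff_mul_wallis (n : ℕ) : ellCoeff n * (2 * n + 1) * Wallis.W n = 1 := by
  induction n with
  | zero => simp [ellCoeff_zero, Wallis.W]
  | succ n ih =>
    have h := ellCoeff_succ n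
    have h2 : ellCoeff (n + 1) = (n + 1 / 2) ^ 2 * ellCoeff n / ((n : ℝ) + 1) ^ 2 := by
      rw [eq_div_iff (by positivity)]; linarith
    refine Eq.trans ?_ ih
    rw [Wallis.W_succ, h2]
    push_cast
    field_simp
    ring

theorem tendsto_mul_ellCoeff : Tendsto (fun n : ℕ => (2 * n + 1) * ellCoeff n) atTop
    (nhds (2 / π)) := by
  have := Wallis.tendsto_W_nhds_pi_div_two.inv₀ (by positivity)
  rw [inv_div] at this
  refine this.congr fun n => ?_
  have h := ellCoeff_mul_wallis n
  exact inv_eq_of_mul_eq_one_left (by linarith)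

theorem tendsto_ellCoeff : Tendsto ellCoeff atTop (nhds 0) := by
  have h : Tendsto (fun n : ℕ => 2 * (n : ℝ) + 1) atTop atTop :=
    tendsto_atTop_add_const_right _ _ (tendsto_natCast_atTop_atTop.const_mul_atTop two_pos)
  refine (tendsto_mul_ellCoeff.div_atTop h).congr fun n => ?_
  field_simp

theorem tendsto_derivCoeff_ellCoeff : Tendsto (derivCoeff ellCoeff) atTop (nhds (1 / π)) := by
  have h1 := (tendsto_add_atTop_iff_nat 1).2 tendsto_mul_ellCoeff
  have h2 := (tendsto_add_atTop_iff_nat 1).2 tendsto_ellCoeff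
  have h3 := (h1.sub h2).div_const 2
  have e : (2 / π - 0) / 2 = 1 / π := by ring
  rw [e] at h3
  refine h3.congr fun n => ?_
  simp only [derivCoeff]; push_cast; ring

/-- Legendre's relation. -/
theorem ellF_legendre {x : ℝ} (hx : x ∈ Set.Ioo (0 : ℝ) 1) :
    x * (1 - x) * (ellF' x * ellF (1 - x) + ellF x * ellF' (1 - x)) = 1 / π := by
  set L : ℝ → ℝ := fun x => x * (1 - x) * ellF' x * ellF (1 - x)
    + ellF x * ((1 - x) * (1 - (1 - x)) * ellF' (1 - x)) with hL
  have hd : ∀ y ∈ Set.Ioo (0 : ℝ) 1, HasDerivAt L 0 y := by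
    intro y hy
    have hy1 : |y| < 1 := by rw [abs_of_pos hy.1]; exact hy.2
    have hy2 : |1 - y| < 1 := by rw [abs_of_pos (sub_pos.2 hy.2)]; linarith [hy.1]
    have hs : HasDerivAt (fun y : ℝ => 1 - y) (-1) y := (hasDerivAt_id y).const_sub 1
    have a1 := (hasDerivAt_mul_ellF' hy1).mul ((hasDerivAt_ellF hy2).comp y hs)
    have a2 := (hasDerivAt_ellF hy1).mul ((hasDerivAt_mul_ellF' hy2).comp y hs)
    convert! a1.add a2 using 1
    simp only [Function.comp_apply]
    ring
  have hconst : ∀ y ∈ Set.Ioo (0 : ℝ) 1, L y = L x := fun y hy =>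
    isOpen_Ioo.is_const_of_deriv_eq_zero isPreconnected_Ioo
      (fun z hz => (hd z hz).differentiableAt.differentiableWithinAt)
      (fun z hz => (hd z hz).deriv) hy hx
  have t1 := tendsto_one_sub_mul_powerSum radiusGE_ellCoeff.deriv tendsto_derivCoeff_ellCoeff
  have t2 := tendsto_one_sub_mul_powerSum radiusGE_ellCoeff tendsto_ellCoeff
  have hx0 : Tendsto (fun y : ℝ => y) (nhdsWithin 1 (Set.Iio 1)) (nhds 1) := nhdsWithin_le_nhds
  have hs : Tendsto (fun y : ℝ => 1 - y) (nhdsWithin 1 (Set.Iio 1)) (nhds 0) := by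
    simpa using hx0.const_sub 1
  have t3 : Tendsto (fun y => ellF (1 - y)) (nhdsWithin 1 (Set.Iio 1)) (nhds (ellF 0)) :=
    (hasDerivAt_ellF (by simp)).continuousAt.tendsto.comp hs
  have t4 : Tendsto (fun y => ellF' (1 - y)) (nhdsWithin 1 (Set.Iio 1)) (nhds (ellF' 0)) :=
    (radiusGE_ellCoeff.deriv.hasDerivAt (by simp)).continuousAt.tendsto.comp hs
  have t5 := ((hx0.mul t1).mul t3).add ((t2.mul hx0).mul t4)
  have t6 : Tendsto L (nhdsWithin 1 (Set.Iio 1)) (nhds (1 / π)) := by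
    have e : 1 * (1 / π) * ellF 0 + 0 * 1 * ellF' 0 = 1 / π := by rw [ellF_zero]; ring
    rw [e] at t5
    refine t5.congr fun y => ?_
    simp only [hL, ellF, ellF']
    ring
  have t7 : Tendsto L (nhdsWithin 1 (Set.Iio 1)) (nhds (L x)) := by
    refine tendsto_const_nhds.congr' ?_
    filter_upwards [Ioo_mem_nhdsLT (zero_lt_one' ℝ)] with y hy
    exact (hconst y hy).symm
  rw [tendsto_nhds_unique t6 t7, hL]
  ring

end EllipticSeries

section QuadraticTransformation

theorem ellF'_zero : ellF' 0 = 1 / 4 := by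
  have := ellCoeff_succ 0
  rw [ellF', powerSum_zero, derivCoeff]
  rw [ellCoeff_zero] at this
  norm_num at this ⊢
  linarith

theorem abs_one_sub_inv_sq_lt {w : ℝ} (hw : 1 ≤ w) : |1 - 1 / w ^ 2| < 1 := by
  have h1 : 0 < 1 / w ^ 2 := by positivity
  have h2 : 1 / w ^ 2 ≤ 1 := by
    rw [div_le_one (by positivity)]; exact one_le_pow₀ hw
  rw [abs_of_nonneg (by linarith)]; linarith

theorem abs_neg_sq_div_lt {w : ℝ} (hw : w ∈ Set.Icc (1 : ℝ) 3) :
    |-(w - 1) ^ 2 / (4 * w)| < 1 := by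
  obtain ⟨h1, h3⟩ := hw
  rw [neg_div, abs_neg, abs_of_nonneg (by positivity), div_lt_one (by positivity)]
  nlinarith

theorem hasDerivAt_one_sub_inv_sq {w : ℝ} (hw : w ≠ 0) :
    HasDerivAt (fun w : ℝ => 1 - 1 / w ^ 2) (2 / w ^ 3) w := by
  convert! ((hasDerivAt_const w (1 : ℝ)).div (hasDerivAt_pow 2 w) (pow_ne_zero 2 hw)).const_sub 1
    using 1
  field_simp
  norm_num

theorem hasDerivAt_neg_sq_div {w : ℝ} (hw : w ≠ 0) :
    HasDerivAt (fun w : ℝ => -(w - 1) ^ 2 / (4 * w)) (-(w ^ 2 - 1) / (4 * w ^ 2)) w := by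
  have h1 : HasDerivAt (fun w : ℝ => -(w - 1) ^ 2) _ w :=
    (((hasDerivAt_id w).sub_const 1).pow 2).neg
  have h2 : HasDerivAt (fun w : ℝ => 4 * w) _ w := (hasDerivAt_id w).const_mul 4
  convert! h1.div h2 (by simpa using hw) using 1
  simp only [id]
  field_simp
  push_cast
  ring

/-- The Wronskian of `F(1 - 1/w²)` and `√w F(-(w-1)²/(4w))` vanishes on `[1, 3]`. -/
theorem ellF_wronskian_eq_zero {w : ℝ} (hw : w ∈ Set.Icc (1 : ℝ) 3) :
    ellF (1 - 1 / w ^ 2) * ellF (-(w - 1) ^ 2 / (4 * w))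
      - (w ^ 2 - 1) / (2 * w) * ellF (1 - 1 / w ^ 2) * ellF' (-(w - 1) ^ 2 / (4 * w))
      - 4 / w ^ 2 * ellF' (1 - 1 / w ^ 2) * ellF (-(w - 1) ^ 2 / (4 * w)) = 0 := by
  let p : ℝ → ℝ := fun w => 1 - 1 / w ^ 2
  let q : ℝ → ℝ := fun w => -(w - 1) ^ 2 / (4 * w)
  let gp : ℝ → ℝ := fun w => p w * (1 - p w) * ellF' (p w)
  let gq : ℝ → ℝ := fun w => q w * (1 - q w) * ellF' (q w)
  let V : ℝ → ℝ := fun w => ellF (p w) * (2 * gq w + (w ^ 2 - 1) / (4 * w) * ellF (q w))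
    - w * ellF (q w) * gp w
  have hV : ∀ y ∈ Set.Icc (1 : ℝ) 3, HasDerivAt V (V y / (2 * y)) y := by
    intro y hy
    have hy0 : y ≠ 0 := by linarith [hy.1]
    have hp := hasDerivAt_one_sub_inv_sq hy0
    have hq := hasDerivAt_neg_sq_div hy0
    have h1 := (hasDerivAt_ellF (abs_one_sub_inv_sq_lt hy.1)).comp y hp
    have h2 := (hasDerivAt_ellF (abs_neg_sq_div_lt hy)).comp y hq
    have h3 := (hasDerivAt_mul_ellF' (abs_one_sub_inv_sq_lt hy.1)).comp y hp
    have h4 := (hasDerivAt_mul_ellF' (abs_neg_sq_div_lt hy)).comp y hq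
    have h5 : HasDerivAt (fun w : ℝ => (w ^ 2 - 1) / (4 * w)) _ y :=
      ((hasDerivAt_pow 2 y).sub_const 1).div ((hasDerivAt_id y).const_mul 4)
        (by simpa using hy0)
    convert! (h1.mul ((h4.const_mul 2).add (h5.mul h2))).sub
      (((hasDerivAt_id y).mul h2).mul h3) using 1
    simp only [V, gp, gq, p, q, Function.comp_apply, id, Pi.add_apply, Pi.mul_apply]
    generalize ellF (1 - 1 / y ^ 2) = a
    generalize ellF' (1 - 1 / y ^ 2) = b
    generalize ellF (-(y - 1) ^ 2 / (4 * y)) = c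
    generalize ellF' (-(y - 1) ^ 2 / (4 * y)) = d
    field_simp
    push_cast
    ring
  have hW : ∀ y ∈ Set.Icc (1 : ℝ) 3, HasDerivAt (fun w => V w ^ 2 / w) 0 y := by
    intro y hy
    have hy0 : y ≠ 0 := by linarith [hy.1]
    convert! ((hV y hy).pow 2).div (hasDerivAt_id y) hy0 using 1
    simp only [id, Pi.pow_apply]
    field_simp
    push_cast
    ring
  have hVw := constant_of_has_deriv_right_zero
    (fun y hy => (hW y hy).continuousAt.continuousWithinAt)
    (fun y hy => (hW y ⟨hy.1, hy.2.le⟩).hasDerivWithinAt) w hw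
  have hw0 : w ≠ 0 := by linarith [hw.1]
  have hV1 : V 1 = 0 := by simp [V, gp, gq, p, q]
  rw [hV1] at hVw
  have hV0 : V w = 0 := by simpa [hw0] using hVw
  rcases hw.1.eq_or_lt with rfl | hw1
  · norm_num [ellF_zero, ellF'_zero]
  have hne : (w ^ 2 - 1) / (4 * w) ≠ 0 := by
    have : 0 < w ^ 2 - 1 := by nlinarith
    positivity
  refine (mul_eq_zero.1 (Eq.trans ?_ hV0)).resolve_left hne
  simp only [V, gp, gq, p, q]
  generalize ellF (1 - 1 / w ^ 2) = a
  generalize ellF' (1 - 1 / w ^ 2) = b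
  generalize ellF (-(w - 1) ^ 2 / (4 * w)) = c
  generalize ellF' (-(w - 1) ^ 2 / (4 * w)) = d
  field_simp
  ring

/-- A quadratic transformation of `₂F₁(1/2, 1/2; 1; x)`. -/
theorem ellF_one_sub_inv_sq {w : ℝ} (hw : w ∈ Set.Icc (1 : ℝ) 3) :
    ellF (1 - 1 / w ^ 2) = √w * ellF (-(w - 1) ^ 2 / (4 * w)) := by
  have hpos : ∀ y : ℝ, 1 ≤ y → 0 < ellF (1 - 1 / y ^ 2) := fun y hy => by
    have h := abs_one_sub_inv_sq_lt hy
    have : 1 / y ^ 2 ≤ 1 := by rw [div_le_one (by positivity)]; exact one_le_pow₀ hy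
    exact one_pos.trans_le (one_le_ellF (by linarith) (abs_lt.1 h).2)
  have hR : ∀ y ∈ Set.Icc (1 : ℝ) 3,
      HasDerivAt (fun w => √w * ellF (-(w - 1) ^ 2 / (4 * w)) / ellF (1 - 1 / w ^ 2)) 0 y := by
    intro y hy
    have hy0 : 0 < y := by linarith [hy.1]
    have h1 := (hasDerivAt_ellF (abs_one_sub_inv_sq_lt hy.1)).comp y
      (hasDerivAt_one_sub_inv_sq hy0.ne')
    have h2 := (hasDerivAt_ellF (abs_neg_sq_div_lt hy)).comp y (hasDerivAt_neg_sq_div hy0.ne')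
    have hW := ellF_wronskian_eq_zero hy
    have hp := hpos y hy.1
    convert! ((Real.hasDerivAt_sqrt hy0.ne').mul h2).div h1 hp.ne' using 1
    simp only [Function.comp_apply, Pi.mul_apply]
    have hs : 0 < √y := Real.sqrt_pos.2 hy0
    have hs2 : √y ^ 2 = y := Real.sq_sqrt hy0.le
    revert hW hp
    generalize ellF (1 - 1 / y ^ 2) = a
    generalize ellF' (1 - 1 / y ^ 2) = b
    generalize ellF (-(y - 1) ^ 2 / (4 * y)) = c
    generalize ellF' (-(y - 1) ^ 2 / (4 * y)) = d
    intro hW hp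
    symm
    rw [div_eq_zero_iff]
    left
    have key : (1 / (2 * √y) * c + √y * (d * (-(y ^ 2 - 1) / (4 * y ^ 2)))) * a
        - √y * c * (b * (2 / y ^ 3))
        = 1 / (2 * √y) * (a * c - (y ^ 2 - 1) / (2 * y) * a * d - 4 / y ^ 2 * b * c) := by
      generalize √y = s at hs hs2
      subst hs2
      field_simp
      ring
    rw [key, hW, mul_zero]
  have h := constant_of_has_deriv_right_zero
    (fun y hy => (hR y hy).continuousAt.continuousWithinAt)
    (fun y hy => (hR y ⟨hy.1, hy.2.le⟩).hasDerivWithinAt) w hw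
  have h1 := hpos w hw.1
  norm_num [ellF_zero] at h
  rw [div_eq_iff (by simpa using h1.ne')] at h
  simpa using h.symm

end QuadraticTransformation

section ProductFormula

/-- The coefficient of `x ^ r` in `x ^ q * (1 + ε x) ^ p`. -/
def binomCoeff (ε : ℝ) (q p r : ℕ) : ℝ :=
  if q ≤ r then ε ^ (r - q) * (p.choose (r - q) : ℝ) else 0

theorem binomCoeff_add (ε : ℝ) (q p k : ℕ) :
    binomCoeff ε q p (q + k) = ε ^ k * (p.choose k : ℝ) := by
  simp [binomCoeff]

theorem binomCoeff_of_lt (ε : ℝ) {q r : ℕ} (p : ℕ) (h : r < q) : binomCoeff ε q p r = 0 := by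
  simp [binomCoeff, h]

theorem binomCoeff_succ_succ (ε : ℝ) (q p r : ℕ) :
    binomCoeff ε (q + 1) p (r + 1) = binomCoeff ε q p r := by
  simp [binomCoeff]

theorem abs_binomCoeff_neg_one (q p r : ℕ) : |binomCoeff (-1) q p r| = binomCoeff 1 q p r := by
  unfold binomCoeff
  split_ifs <;> simp [abs_mul]

theorem hasSum_binomCoeff (ε x : ℝ) (q p : ℕ) :
    HasSum (fun r => binomCoeff ε q p r * x ^ r) (x ^ q * (1 + ε * x) ^ p) := by
  have hinj : Function.Injective fun k : ℕ => q + k := add_right_injective q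
  rw [← hinj.hasSum_iff (fun r hr => by
    rw [binomCoeff_of_lt, zero_mul]
    by_contra! h
    exact hr ⟨r - q, by simp only; omega⟩)]
  have : x ^ q * (1 + ε * x) ^ p = ∑ k ∈ Finset.range (p + 1),
      ((fun r => binomCoeff ε q p r * x ^ r) ∘ fun k => q + k) k := by
    rw [add_comm, add_pow, Finset.mul_sum]
    refine Finset.sum_congr rfl fun k _ => ?_
    simp only [Function.comp_apply, binomCoeff_add, pow_add, mul_pow]
    ring
  rw [this]
  refine hasSum_sum_of_ne_finset_zero fun k hk => ?_
  have : p.choose k = 0 := Nat.choose_eq_zero_of_lt (by simpa using hk)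
  simp [binomCoeff_add, this]

theorem binomCoeff_exponent_succ (q p r : ℕ) :
    binomCoeff (-1) q (p + 1) r = binomCoeff (-1) q p r - binomCoeff (-1) (q + 1) p r := by
  rcases lt_or_ge r q with h | h
  · simp [binomCoeff_of_lt _ _ h, binomCoeff_of_lt _ _ (h.trans q.lt_succ_self)]
  obtain ⟨k, rfl⟩ := Nat.exists_eq_add_of_le h
  rcases k with _ | k
  · rw [binomCoeff_of_lt (-1) (q := q + 1) p (by omega), binomCoeff_add, binomCoeff_add]
    simp
  · rw [binomCoeff_add, binomCoeff_add, show q + (k + 1) = q + 1 + k by ring, binomCoeff_add,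
      Nat.choose_succ_succ]
    push_cast; ring

/-- Action of the hypergeometric differential operator on `x ^ m * (1 - x) ^ n`. -/
theorem binomCoeff_hypergeometric (m n i : ℕ) :
    (((i : ℝ) + 1) ^ 2 - m ^ 2) * binomCoeff (-1) m n (i + 1)
        - (i + 1 / 2) ^ 2 * binomCoeff (-1) m n i
      = n ^ 2 * binomCoeff (-1) m (n - 1) i
        - (m + n + 1 / 2) ^ 2 * binomCoeff (-1) m n i := by
  rcases lt_trichotomy (i + 1) m with h | rfl | h
  · simp [binomCoeff_of_lt _ _ h, binomCoeff_of_lt _ _ (i.lt_succ_self.trans h)]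
  · simp [binomCoeff_of_lt _ _ i.lt_succ_self]
  obtain ⟨k, rfl⟩ := Nat.exists_eq_add_of_le (Nat.lt_succ_iff.1 h)
  rw [add_assoc, binomCoeff_add, binomCoeff_add, binomCoeff_add]
  rcases n with _ | n
  · rcases k with _ | k <;> simp
  · have h1 : ((n : ℝ) + 1) * (n.choose k : ℝ) = ((n + 1).choose (k + 1) : ℝ) * (k + 1) := by
      exact_mod_cast Nat.add_one_mul_choose_eq n k
    have h3 : ((n + 1).choose (k + 1) : ℝ) * (k + 1) = ((n + 1).choose k : ℝ) * (n + 1 - k) := by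
      have := Nat.choose_succ_right_eq (n + 1) k
      rcases le_or_gt k (n + 1) with hk | hk
      · have h4 : ((n + 1).choose (k + 1) : ℝ) * (k + 1)
            = ((n + 1).choose k : ℝ) * ((n + 1 - k : ℕ) : ℝ) := by exact_mod_cast this
        rw [h4, Nat.cast_sub hk]; push_cast; ring
      · rw [Nat.choose_eq_zero_of_lt hk, Nat.choose_eq_zero_of_lt (by omega)]; simp
    rw [Nat.add_sub_cancel, pow_succ]
    push_cast
    linear_combination (-1 : ℝ) ^ k * (-((n : ℝ) + 1) * h1 - (2 * m + n + 1 + k + 1) * h3)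

/-- The coefficients `(1/2)_{m+n}² / (m!² n!²)` of the Appell function
`F₄(1/2, 1/2; 1, 1; x, y)`. -/
noncomputable def appellCoeff (m n : ℕ) : ℝ := ellCoeff (m + n) * ((m + n).choose m : ℝ) ^ 2

theorem appellCoeff_comm (m n : ℕ) : appellCoeff m n = appellCoeff n m := by
  rw [appellCoeff, appellCoeff, add_comm m n, Nat.choose_symm_add]

theorem appellCoeff_succ_left (m n : ℕ) :
    ((m : ℝ) + 1) ^ 2 * appellCoeff (m + 1) n = (m + n + 1 / 2) ^ 2 * appellCoeff m n := by
  have h1 := ellCoeff_succ (m + n)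
  have h2 : ((m : ℝ) + n + 1) * ((m + n).choose m : ℝ)
      = ((m + n + 1).choose (m + 1) : ℝ) * (m + 1) := by
    exact_mod_cast Nat.add_one_mul_choose_eq (m + n) m
  push_cast at h1
  rw [appellCoeff, appellCoeff, show m + 1 + n = m + n + 1 by ring]
  have h3 : ((m : ℝ) + 1) ^ 2 * (ellCoeff (m + n + 1) * ((m + n + 1).choose (m + 1) : ℝ) ^ 2)
      = ellCoeff (m + n + 1) * (((m : ℝ) + n + 1) * ((m + n).choose m : ℝ)) ^ 2 := by
    rw [h2]; ring
  rw [h3]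
  linear_combination ((m + n).choose m : ℝ) ^ 2 * h1

theorem appellCoeff_succ_right (m n : ℕ) :
    ((n : ℝ) + 1) ^ 2 * appellCoeff m (n + 1) = (m + n + 1 / 2) ^ 2 * appellCoeff m n := by
  rw [appellCoeff_comm m, appellCoeff_succ_left, appellCoeff_comm m]
  ring

/-- The coefficient of `x ^ i * y ^ j` in `F₄(1/2, 1/2; 1, 1; x (1 - y), y (1 - x))` is the
product of the coefficients of `x ^ i` and `y ^ j` in the one-variable series. -/
theorem sum_appellCoeff_mul_binomCoeff {M N i j : ℕ} (hi : i < M) (hj : j < N) :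
    ∑ m ∈ Finset.range M, ∑ n ∈ Finset.range N,
      appellCoeff m n * (binomCoeff (-1) m n i * binomCoeff (-1) n m j)
      = ellCoeff i * ellCoeff j := by
  induction i with
  | zero =>
    rw [Finset.sum_eq_single_of_mem 0 (Finset.mem_range.2 hi) fun m _ hm =>
      Finset.sum_eq_zero fun n _ => by rw [binomCoeff_of_lt _ _ (Nat.pos_of_ne_zero hm)]; simp,
      Finset.sum_eq_single_of_mem j (Finset.mem_range.2 hj)]
    · simp [binomCoeff, appellCoeff, ellCoeff_zero]
    · intro n _ hn
      rcases lt_or_gt_of_ne hn with h | h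
      · have : (Nat.choose 0 (j - n)) = 0 := Nat.choose_eq_zero_of_lt (by omega)
        simp [binomCoeff, this]
      · simp [binomCoeff_of_lt _ _ h]
  | succ i ih =>
    have ih := ih (by omega)
    let f : ℕ → ℕ → ℝ := fun n m =>
      appellCoeff m n * m ^ 2 * binomCoeff (-1) m n (i + 1) * binomCoeff (-1) n m j
    let h : ℕ → ℕ → ℝ := fun m n =>
      appellCoeff m n * n ^ 2 * binomCoeff (-1) m (n - 1) i * binomCoeff (-1) n m j
    have hf : ∑ m ∈ Finset.range M, ∑ n ∈ Finset.range N, (f n m - f n (m + 1)) = 0 := by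
      rw [Finset.sum_comm]
      refine Finset.sum_eq_zero fun n _ => ?_
      rw [Finset.sum_range_sub']
      simp [f, binomCoeff_of_lt _ _ hi]
    have hh : ∑ m ∈ Finset.range M, ∑ n ∈ Finset.range N, (h m n - h m (n + 1)) = 0 := by
      refine Finset.sum_eq_zero fun m _ => ?_
      rw [Finset.sum_range_sub']
      simp [h, binomCoeff_of_lt _ _ hj]
    have key : ∀ m n : ℕ, ((i : ℝ) + 1) ^ 2 *
          (appellCoeff m n * (binomCoeff (-1) m n (i + 1) * binomCoeff (-1) n m j))
        = (i + 1 / 2) ^ 2 *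
          (appellCoeff m n * (binomCoeff (-1) m n i * binomCoeff (-1) n m j))
          + ((f n m - f n (m + 1)) + (h m n - h m (n + 1))) := by
      intro m n
      simp only [f, h, Nat.add_sub_cancel, binomCoeff_succ_succ, binomCoeff_exponent_succ]
      push_cast
      linear_combination appellCoeff m n * binomCoeff (-1) n m j * binomCoeff_hypergeometric m n i
        + binomCoeff (-1) m n i * (binomCoeff (-1) n m j - binomCoeff (-1) (n + 1) m j)
          * appellCoeff_succ_left m n
        + binomCoeff (-1) m n i * binomCoeff (-1) (n + 1) m j * appellCoeff_succ_right m n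
    have hsum := Finset.sum_congr (rfl : Finset.range M = _) fun m _ =>
      Finset.sum_congr (rfl : Finset.range N = _) fun n _ => key m n
    simp only [Finset.sum_add_distrib, ← Finset.mul_sum] at hsum hf hh
    rw [hf, hh, ih] at hsum
    have hne : ((i : ℝ) + 1) ^ 2 ≠ 0 := by positivity
    refine mul_left_cancel₀ hne ?_
    linear_combination hsum - ellCoeff j * ellCoeff_succ i

theorem appellCoeff_nonneg (m n : ℕ) : 0 ≤ appellCoeff m n :=
  mul_nonneg (ellCoeff_pos _).le (by positivity)

theorem summable_appellCoeff {X Y p q : ℝ} (hX0 : 0 ≤ X) (hY0 : 0 ≤ Y) (hp : 0 < p) (hq : 0 < q)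
    (hpq : p + q = 1) (hX : X < p ^ 2) (hY : Y < q ^ 2) :
    Summable fun x : ℕ × ℕ => appellCoeff x.1 x.2 * (X ^ x.1 * Y ^ x.2) := by
  have hX1 : X / p ^ 2 < 1 := (div_lt_one (by positivity)).2 hX
  have hY1 : Y / q ^ 2 < 1 := (div_lt_one (by positivity)).2 hY
  refine Summable.of_nonneg_of_le
    (fun x => mul_nonneg (appellCoeff_nonneg _ _) (by positivity)) (fun x => ?_)
    ((summable_geometric_of_lt_one (by positivity) hX1).mul_of_nonneg
      (summable_geometric_of_lt_one (by positivity) hY1)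
      (fun n => by positivity) (fun n => by positivity))
  obtain ⟨m, n⟩ := x
  have h1 : ((m + n).choose m : ℝ) * (p ^ m * q ^ n) ≤ 1 := by
    have := Finset.single_le_sum (f := fun k => p ^ k * q ^ (m + n - k) * ((m + n).choose k : ℝ))
      (fun k _ => by positivity) (Finset.mem_range.2 (show m < m + n + 1 by omega))
    rw [← add_pow, hpq, one_pow] at this
    simp only [Nat.add_sub_cancel_left] at this
    linarith
  have h2 : (((m + n).choose m : ℝ) * (p ^ m * q ^ n)) ^ 2 ≤ 1 := pow_le_one₀ (by positivity) h1
  have h3 : appellCoeff m n * (p ^ m * q ^ n) ^ 2 ≤ 1 := by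
    rw [appellCoeff, mul_assoc, ← mul_pow]
    exact mul_le_one₀ (ellCoeff_le_one _) (by positivity) h2
  calc appellCoeff m n * (X ^ m * Y ^ n)
      = appellCoeff m n * (p ^ m * q ^ n) ^ 2 * ((X / p ^ 2) ^ m * (Y / q ^ 2) ^ n) := by
        rw [div_pow, div_pow, mul_pow, ← pow_mul, ← pow_mul, ← pow_mul, ← pow_mul,
          mul_comm 2 m, mul_comm 2 n]
        field_simp
    _ ≤ 1 * ((X / p ^ 2) ^ m * (Y / q ^ 2) ^ n) := by gcongr
    _ = _ := one_mul _

/-- Bailey's factorization of `F₄(1/2, 1/2; 1, 1; x (1 - y), y (1 - x))`, with the double series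
summed along antidiagonals. -/
theorem hasSum_ellF_mul_ellF {x y p q : ℝ} (hp : 0 < p) (hq : 0 < q) (hpq : p + q = 1)
    (hx : |x| * (1 + |y|) < p ^ 2) (hy : |y| * (1 + |x|) < q ^ 2) :
    HasSum (fun n => ellCoeff n * ∑ j ∈ Finset.range (n + 1),
      (n.choose j : ℝ) ^ 2 * (x * (1 - y)) ^ j * (y * (1 - x)) ^ (n - j))
      (ellF x * ellF y) := by
  have hx1 : |x| < 1 := by
    nlinarith [mul_nonneg (abs_nonneg x) (abs_nonneg y)]
  have hy1 : |y| < 1 := by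
    nlinarith [mul_nonneg (abs_nonneg x) (abs_nonneg y)]
  let T : (ℕ × ℕ) × (ℕ × ℕ) → ℝ := fun s => appellCoeff s.1.1 s.1.2 *
    ((binomCoeff (-1) s.1.1 s.1.2 s.2.1 * x ^ s.2.1) *
      (binomCoeff (-1) s.1.2 s.1.1 s.2.2 * y ^ s.2.2))
  have habs : ∀ m n : ℕ, HasSum (fun t => |T ((m, n), t)|)
      (appellCoeff m n * ((|x| * (1 + |y|)) ^ m * (|y| * (1 + |x|)) ^ n)) := by
    intro m n
    have h1 := hasSum_binomCoeff 1 |x| m n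
    have h2 := hasSum_binomCoeff 1 |y| n m
    have hnn : ∀ (z : ℝ) (q p r : ℕ), 0 ≤ binomCoeff 1 q p r * |z| ^ r := fun z q p r => by
      rw [← abs_binomCoeff_neg_one]; positivity
    have h3 := ((h1.mul h2 (h1.summable.mul_of_nonneg h2.summable (hnn x m n) (hnn y n m))).mul_left
      (appellCoeff m n))
    convert! h3 using 1
    · ext t
      simp only [T, abs_mul, abs_pow, abs_binomCoeff_neg_one, abs_of_nonneg (appellCoeff_nonneg _ _)]
    · rw [mul_pow, mul_pow]; ring
  have hT : Summable T := by
    refine Summable.of_abs ?_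
    refine (summable_prod_of_nonneg fun s => abs_nonneg (T s)).2
      ⟨fun s => (habs s.1 s.2).summable, ?_⟩
    simp only [fun s : ℕ × ℕ => (habs s.1 s.2).tsum_eq]
    exact summable_appellCoeff (by positivity) (by positivity) hp hq hpq hx hy
  have hrow : ∀ s : ℕ × ℕ, HasSum (fun t => T (s, t))
      (appellCoeff s.1 s.2 * ((x * (1 - y)) ^ s.1 * (y * (1 - x)) ^ s.2)) := by
    intro s
    have h1 := hasSum_binomCoeff (-1) x s.1 s.2
    have h2 := hasSum_binomCoeff (-1) y s.2 s.1
    have h3 := hT.prod_factor s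
    by_cases h0 : appellCoeff s.1 s.2 = 0
    · simp [T, h0, hasSum_zero]
    have h4 := (h1.mul h2 ((summable_mul_left_iff h0).1 h3)).mul_left (appellCoeff s.1 s.2)
    convert! h4 using 1
    rw [mul_pow, mul_pow]; ring
  have hcol : ∀ t : ℕ × ℕ, HasSum (fun s => T (s, t))
      ((ellCoeff t.1 * x ^ t.1) * (ellCoeff t.2 * y ^ t.2)) := by
    intro t
    have h := sum_appellCoeff_mul_binomCoeff t.1.lt_succ_self t.2.lt_succ_self
    have e : (ellCoeff t.1 * x ^ t.1) * (ellCoeff t.2 * y ^ t.2)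
        = ∑ s ∈ Finset.range (t.1 + 1) ×ˢ Finset.range (t.2 + 1), T (s, t) := by
      rw [Finset.sum_product]
      calc _ = (ellCoeff t.1 * ellCoeff t.2) * (x ^ t.1 * y ^ t.2) := by ring
        _ = _ := by
          rw [← h, Finset.sum_mul]
          refine Finset.sum_congr rfl fun m _ => ?_
          rw [Finset.sum_mul]
          refine Finset.sum_congr rfl fun n _ => ?_
          simp only [T]; ring
    rw [e]
    refine hasSum_sum_of_ne_finset_zero fun s hs => ?_
    simp only [Finset.mem_product, Finset.mem_range, not_and_or, not_lt] at hs
    rcases hs with hs | hs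
    · simp [T, binomCoeff_of_lt _ _ hs]
    · simp [T, binomCoeff_of_lt _ _ hs]
  have hA := hT.hasSum.prod_fiberwise hrow
  have hB := ((Equiv.prodComm (ℕ × ℕ) (ℕ × ℕ)).hasSum_iff.2 hT.hasSum).prod_fiberwise hcol
  have hF := (radiusGE_ellCoeff.summable hx1).hasSum.mul (radiusGE_ellCoeff.summable hy1).hasSum
    hB.summable
  rw [hB.unique hF] at hA
  rw [← Finset.HasAntidiagonal.sigmaAntidiagonalEquivProd.hasSum_iff] at hA
  have hS := hA.sigma fun n => hasSum_fintype _
  convert! hS using 1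
  ext n
  rw [← Finset.Nat.sum_antidiagonal_eq_sum_range_succ
    (fun j k => (n.choose j : ℝ) ^ 2 * (x * (1 - y)) ^ j * (y * (1 - x)) ^ k), Finset.mul_sum,
    ← Finset.sum_coe_sort]
  refine Finset.sum_congr rfl fun s _ => ?_
  have hs := Finset.HasAntidiagonal.mem_antidiagonal.1 s.2
  simp only [Function.comp_apply, Finset.HasAntidiagonal.sigmaAntidiagonalEquivProd_apply, appellCoeff, hs]
  ring

end ProductFormula

section LegendreSeries

theorem abs_legendreP_one_third_le (n : ℕ) : |legendreP n (1 / 3)| ≤ 2 ^ n := by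
  have h : ∀ j ∈ Finset.range (n + 1),
      |(n.choose j : ℝ) ^ 2 * (1 / 3 - 1) ^ (n - j) * (1 / 3 + 1) ^ j|
        ≤ 2 ^ n * ((4 / 3) ^ j * (2 / 3) ^ (n - j) * (n.choose j : ℝ)) := by
    intro j _
    have h1 : (n.choose j : ℝ) ≤ 2 ^ n := by exact_mod_cast Nat.choose_le_two_pow n j
    rw [abs_mul, abs_mul, abs_pow, abs_pow, abs_pow, Nat.abs_cast]
    have e1 : |(1 / 3 - 1 : ℝ)| = 2 / 3 := by norm_num [abs_of_neg]
    have e2 : |(1 / 3 + 1 : ℝ)| = 4 / 3 := by norm_num [abs_of_pos]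
    rw [e1, e2]
    calc (n.choose j : ℝ) ^ 2 * (2 / 3) ^ (n - j) * (4 / 3) ^ j
        = (n.choose j : ℝ) * ((4 / 3) ^ j * (2 / 3) ^ (n - j) * (n.choose j : ℝ)) := by ring
      _ ≤ _ := by gcongr
  rw [legendreP, abs_mul, abs_of_pos (by positivity)]
  calc (2 : ℝ)⁻¹ ^ n * |∑ j ∈ Finset.range (n + 1),
        (n.choose j : ℝ) ^ 2 * (1 / 3 - 1) ^ (n - j) * (1 / 3 + 1) ^ j|
      ≤ (2 : ℝ)⁻¹ ^ n * ∑ j ∈ Finset.range (n + 1),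
          2 ^ n * ((4 / 3) ^ j * (2 / 3) ^ (n - j) * (n.choose j : ℝ)) := by
        gcongr
        exact (Finset.abs_sum_le_sum_abs _ _).trans (Finset.sum_le_sum h)
    _ = 2 ^ n := by
        rw [← Finset.mul_sum, ← add_pow, ← mul_assoc, ← mul_pow, ← mul_pow]
        norm_num

/-- The coefficients of Brafman's generating function at `x = 1/3`. -/
noncomputable def brafmanCoeff (n : ℕ) : ℝ := ellCoeff n * legendreP n (1 / 3)

theorem radiusGE_brafmanCoeff : RadiusGE brafmanCoeff (1 / 2) := by
  rw [one_div]
  refine radiusGE_of_abs_le two_pos fun n => ?_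
  rw [brafmanCoeff, abs_mul, abs_of_pos (ellCoeff_pos n)]
  have := abs_legendreP_one_third_le n
  exact (mul_le_of_le_one_left (abs_nonneg _) (ellCoeff_le_one n)).trans this

theorem RadiusGE.powerSum_eulerCoeff_eq {u : ℕ → ℝ} {r : ℝ} (hu : RadiusGE u r) {U : Set ℝ}
    (hU : IsOpen U) (hUr : ∀ z ∈ U, |z| < r ∧ z ≠ 0) {φ ψ : ℝ → ℝ}
    (hφ : ∀ z ∈ U, powerSum u z = φ z) (hψ : ∀ z ∈ U, HasDerivAt φ (ψ z / z) z) :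
    ∀ z ∈ U, powerSum (eulerCoeff u) z = ψ z := by
  intro z hz
  have h1 := hu.hasDerivAt (hUr z hz).1
  have h2 : HasDerivAt (powerSum u) (ψ z / z) z :=
    (hψ z hz).congr_of_eventuallyEq (by filter_upwards [hU.mem_nhds hz] with y hy using hφ y hy)
  rw [powerSum_eulerCoeff hu (hUr z hz).1, h1.unique h2]
  exact mul_div_cancel₀ _ (hUr z hz).2

/-- The square root `√(1 - 2xz + z²)` at `x = 1/3`. -/
noncomputable def brafmanRoot (z : ℝ) : ℝ := √(1 - 2 / 3 * z + z ^ 2)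

theorem brafmanRoot_pos (z : ℝ) : 0 < brafmanRoot z :=
  Real.sqrt_pos.2 (by nlinarith [sq_nonneg (z - 1 / 3)])

theorem brafmanRoot_sq (z : ℝ) : brafmanRoot z ^ 2 = 1 - 2 / 3 * z + z ^ 2 :=
  Real.sq_sqrt (by nlinarith [sq_nonneg (z - 1 / 3)])

theorem hasDerivAt_brafmanRoot {z : ℝ} (hz : z ≠ 0) :
    HasDerivAt brafmanRoot (-(z * (1 / 3 - z)) / brafmanRoot z / z) z := by
  have hρ := brafmanRoot_pos z
  have h1 : HasDerivAt (fun z : ℝ => 1 - 2 / 3 * z + z ^ 2) _ z :=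
    (((hasDerivAt_id z).const_mul (2 / 3)).const_sub 1).add (hasDerivAt_pow 2 z)
  convert! h1.sqrt (Real.sqrt_pos.1 hρ).ne' using 1
  change _ = _ / (2 * brafmanRoot z)
  field_simp
  push_cast
  ring

/-- The arguments of the hypergeometric factors in Brafman's formula at `x = 1/3`. -/
noncomputable def brafmanArg (ε z : ℝ) : ℝ := (1 - brafmanRoot z + ε * z) / 2

theorem brafmanArg_mul_one_sub {ε : ℝ} (hε : ε ^ 2 = 1) (z : ℝ) :
    brafmanArg ε z * (1 - brafmanArg ε z) = z * (1 / 3 - z + ε * brafmanRoot z) / 2 := by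
  rw [brafmanArg]
  linear_combination -(1 / 4) * brafmanRoot_sq z - z ^ 2 / 4 * hε

theorem hasDerivAt_brafmanArg {ε z : ℝ} (hε : ε ^ 2 = 1) (hz : z ≠ 0) :
    HasDerivAt (brafmanArg ε)
      (brafmanArg ε z * (1 - brafmanArg ε z) / brafmanRoot z / z) z := by
  have hρ := brafmanRoot_pos z
  convert! (((hasDerivAt_brafmanRoot hz).const_sub 1).add
    ((hasDerivAt_id z).const_mul ε)).div_const 2 using 1
  rw [brafmanArg_mul_one_sub hε]
  field_simp

theorem hasDerivAt_ellF_brafmanArg {ε z : ℝ} (hε : ε ^ 2 = 1) (hz : z ≠ 0)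
    (h : |brafmanArg ε z| < 1) :
    HasDerivAt (fun z => ellF (brafmanArg ε z))
      (brafmanArg ε z * (1 - brafmanArg ε z) * ellF' (brafmanArg ε z) / brafmanRoot z / z) z := by
  convert! (hasDerivAt_ellF h).comp z (hasDerivAt_brafmanArg hε hz) using 1
  ring

theorem hasDerivAt_mul_ellF'_brafmanArg {ε z : ℝ} (hε : ε ^ 2 = 1) (hz : z ≠ 0)
    (h : |brafmanArg ε z| < 1) :
    HasDerivAt
      (fun z => brafmanArg ε z * (1 - brafmanArg ε z) * ellF' (brafmanArg ε z))
      (z * (1 / 3 - z + ε * brafmanRoot z) / 2 * ellF (brafmanArg ε z)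
        / (4 * brafmanRoot z) / z) z := by
  have hρ := brafmanRoot_pos z
  convert! (hasDerivAt_mul_ellF' h).comp z (hasDerivAt_brafmanArg hε hz) using 1
  rw [brafmanArg_mul_one_sub hε]
  field_simp

/-- A neighbourhood of `-4/9` on which Brafman's formula holds. -/
def brafmanDomain : Set ℝ :=
  {z | (|z| < 1 / 2 ∧ z < 0) ∧ (|brafmanArg 1 z| < 1 ∧ |brafmanArg (-1) z| < 1) ∧
    |brafmanArg 1 z| * (1 + |brafmanArg (-1) z|) < (11 / 18) ^ 2 ∧
    |brafmanArg (-1) z| * (1 + |brafmanArg 1 z|) < (7 / 18) ^ 2}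

theorem isOpen_brafmanDomain : IsOpen brafmanDomain := by
  have h0 : Continuous brafmanRoot := by unfold brafmanRoot; fun_prop
  have h : ∀ ε, Continuous (brafmanArg ε) := fun ε => by unfold brafmanArg; fun_prop
  have h1 := (h 1).abs
  have h2 := (h (-1)).abs
  exact ((isOpen_lt continuous_abs continuous_const).inter
    (isOpen_lt continuous_id continuous_const)).inter
    (((isOpen_lt h1 continuous_const).inter (isOpen_lt h2 continuous_const)).inter
    ((isOpen_lt (h1.mul (h2.const_add 1)) continuous_const).inter
    (isOpen_lt (h2.mul (h1.const_add 1)) continuous_const)))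

theorem brafmanRoot_neg_four_ninths : brafmanRoot (-4 / 9) = 11 / 9 := by
  rw [brafmanRoot, Real.sqrt_eq_iff_mul_self_eq (by norm_num) (by norm_num)]
  norm_num

theorem brafmanArg_one_neg_four_ninths : brafmanArg 1 (-4 / 9) = -1 / 3 := by
  rw [brafmanArg, brafmanRoot_neg_four_ninths]; norm_num

theorem brafmanArg_neg_one_neg_four_ninths : brafmanArg (-1) (-4 / 9) = 1 / 9 := by
  rw [brafmanArg, brafmanRoot_neg_four_ninths]; norm_num

theorem neg_four_ninths_mem_brafmanDomain : (-4 / 9 : ℝ) ∈ brafmanDomain := by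
  simp only [brafmanDomain, Set.mem_ofPred_eq, brafmanArg_one_neg_four_ninths,
    brafmanArg_neg_one_neg_four_ninths]
  norm_num [abs_of_pos, abs_of_neg]

/-- Brafman's formula at `x = 1/3`. -/
theorem powerSum_brafmanCoeff {z : ℝ} (hz : z ∈ brafmanDomain) :
    powerSum brafmanCoeff z = ellF (brafmanArg 1 z) * ellF (brafmanArg (-1) z) := by
  have h := hasSum_ellF_mul_ellF (by norm_num) (by norm_num) (by norm_num) hz.2.2.1 hz.2.2.2
  rw [← h.tsum_eq, powerSum]
  refine tsum_congr fun n => ?_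
  have e1 : brafmanArg 1 z * (1 - brafmanArg (-1) z) = z * (4 / 3) / 2 := by
    simp only [brafmanArg]; linear_combination -(1 / 4) * brafmanRoot_sq z
  have e2 : brafmanArg (-1) z * (1 - brafmanArg 1 z) = z * (-2 / 3) / 2 := by
    simp only [brafmanArg]; linear_combination -(1 / 4) * brafmanRoot_sq z
  rw [e1, e2, brafmanCoeff, legendreP, mul_assoc, mul_assoc, Finset.sum_mul, Finset.mul_sum]
  congr 1
  refine Finset.sum_congr rfl fun j hj => ?_
  have hj' : j + (n - j) = n := by have := Finset.mem_range.1 hj; omega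
  generalize n - j = k at hj'
  subst hj'
  rw [div_pow, div_pow, mul_pow, mul_pow, inv_pow, pow_add, pow_add]
  norm_num
  field_simp

theorem powerSum_brafmanCoeff_combination :
    powerSum brafmanCoeff (-4 / 9) - 3 * powerSum (eulerCoeff brafmanCoeff) (-4 / 9)
      - 84 * powerSum (eulerCoeff (eulerCoeff brafmanCoeff)) (-4 / 9)
      - 121 * powerSum (eulerCoeff (eulerCoeff (eulerCoeff brafmanCoeff))) (-4 / 9)
      = 12 * ellF (-1 / 3) * ellF (1 / 9) - 16 * ellF' (-1 / 3) * ellF (1 / 9)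
        + 16 / 3 * ellF (-1 / 3) * ellF' (1 / 9) := by
  let f : ℝ → ℝ := fun z => ellF (brafmanArg 1 z)
  let g : ℝ → ℝ := fun z => brafmanArg 1 z * (1 - brafmanArg 1 z) * ellF' (brafmanArg 1 z)
  let h : ℝ → ℝ := fun z => ellF (brafmanArg (-1) z)
  let k : ℝ → ℝ := fun z =>
    brafmanArg (-1) z * (1 - brafmanArg (-1) z) * ellF' (brafmanArg (-1) z)
  let ρ := brafmanRoot
  let σ : ℝ → ℝ := fun z => z * (1 / 3 - z)
  let τ : ℝ → ℝ := fun z => z * (1 / 3 - 2 * z)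
  let A : ℝ → ℝ := fun z => z * (1 / 3 - z + 1 * ρ z) / 2
  let B : ℝ → ℝ := fun z => z * (1 / 3 - z + -1 * ρ z) / 2
  have hρ : ∀ z, 0 < ρ z := brafmanRoot_pos
  have hne : ∀ z ∈ brafmanDomain, z ≠ 0 := fun z hz => hz.1.2.ne
  have dρ : ∀ z ∈ brafmanDomain, HasDerivAt ρ (-σ z / ρ z / z) z := fun z hz =>
    hasDerivAt_brafmanRoot (hne z hz)
  have df : ∀ z ∈ brafmanDomain, HasDerivAt f (g z / ρ z / z) z := fun z hz =>
    hasDerivAt_ellF_brafmanArg (by norm_num) (hne z hz) hz.2.1.1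
  have dh : ∀ z ∈ brafmanDomain, HasDerivAt h (k z / ρ z / z) z := fun z hz =>
    hasDerivAt_ellF_brafmanArg (by norm_num) (hne z hz) hz.2.1.2
  have dg : ∀ z ∈ brafmanDomain, HasDerivAt g (A z * f z / (4 * ρ z) / z) z := fun z hz =>
    hasDerivAt_mul_ellF'_brafmanArg (by norm_num) (hne z hz) hz.2.1.1
  have dk : ∀ z ∈ brafmanDomain, HasDerivAt k (B z * h z / (4 * ρ z) / z) z := fun z hz =>
    hasDerivAt_mul_ellF'_brafmanArg (by norm_num) (hne z hz) hz.2.1.2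
  have dσ : ∀ z ∈ brafmanDomain, HasDerivAt σ (τ z / z) z := fun z hz => by
    have := hne z hz
    convert! (hasDerivAt_id z).mul ((hasDerivAt_id z).const_sub (1 / 3)) using 1
    simp only [τ, id]; field_simp; ring
  have hAB : ∀ z, A z + B z = σ z := fun z => by simp only [A, B, σ]; ring
  have hr := radiusGE_brafmanCoeff
  have hU : ∀ z ∈ brafmanDomain, |z| < 1 / 2 ∧ z ≠ 0 := fun z hz => ⟨hz.1.1, hne z hz⟩
  have S0 : ∀ z ∈ brafmanDomain, powerSum brafmanCoeff z = (f * h) z :=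
    fun z hz => powerSum_brafmanCoeff hz
  have S1 := hr.powerSum_eulerCoeff_eq isOpen_brafmanDomain hU S0
    (ψ := (g * h + f * k) / ρ) fun z hz => by
      have hz0 := hne z hz
      have hρz := hρ z
      convert! (df z hz).mul (dh z hz) using 1
      simp only [Pi.add_apply, Pi.mul_apply, Pi.div_apply]
      field_simp
  have S2 := hr.euler.powerSum_eulerCoeff_eq isOpen_brafmanDomain hU S1
    (ψ := (σ * (f * h) / 4 + 2 * (g * k)) / ρ ^ 2 + σ * (g * h + f * k) / ρ ^ 3) fun z hz => by
      have hz0 := hne z hz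
      have hρz := hρ z
      convert! (((dg z hz).mul (dh z hz)).add ((df z hz).mul (dk z hz))).div (dρ z hz) hρz.ne' using 1
      simp only [Pi.add_apply, Pi.mul_apply, Pi.div_apply, Pi.pow_apply, Pi.ofNat_apply]
      rw [← hAB]
      field_simp
      ring
  have S3 := hr.euler.euler.powerSum_eulerCoeff_eq isOpen_brafmanDomain hU S2
    (ψ := τ * (f * h) / (4 * ρ ^ 2) + σ * (g * h + f * k) / (4 * ρ ^ 3)
      + σ ^ 2 * (f * h) / (2 * ρ ^ 4) + (A * f * k + B * g * h) / (2 * ρ ^ 3)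
      + 4 * σ * (g * k) / ρ ^ 4 + τ * (g * h + f * k) / ρ ^ 3
      + σ * (σ * (f * h) / 4 + 2 * (g * k)) / ρ ^ 4
      + 3 * σ ^ 2 * (g * h + f * k) / ρ ^ 5) fun z hz => by
      have hz0 := hne z hz
      have hρz := hρ z
      have d1 := (((dσ z hz).mul ((df z hz).mul (dh z hz))).div_const 4).add
        (((dg z hz).mul (dk z hz)).const_mul 2)
      have d2 := (dσ z hz).mul (((dg z hz).mul (dh z hz)).add ((df z hz).mul (dk z hz)))
      convert! (d1.div ((dρ z hz).pow 2) (pow_ne_zero 2 hρz.ne')).add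
        (d2.div ((dρ z hz).pow 3) (pow_ne_zero 3 hρz.ne')) using 1
      simp only [Pi.add_apply, Pi.mul_apply, Pi.div_apply, Pi.pow_apply, Pi.ofNat_apply]
      rw [← hAB]
      field_simp
      push_cast
      ring
  have hz := neg_four_ninths_mem_brafmanDomain
  rw [S0 _ hz, S1 _ hz, S2 _ hz, S3 _ hz]
  simp only [Pi.add_apply, Pi.mul_apply, Pi.div_apply, Pi.pow_apply, Pi.ofNat_apply,
    f, g, h, k, ρ, σ, τ, A, B, brafmanRoot_neg_four_ninths, brafmanArg_one_neg_four_ninths,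
    brafmanArg_neg_one_neg_four_ninths]
  ring

theorem ellF_combination_eq :
    12 * ellF (-1 / 3) * ellF (1 / 9) - 16 * ellF' (-1 / 3) * ellF (1 / 9)
        + 16 / 3 * ellF (-1 / 3) * ellF' (1 / 9) = 18 * √3 / π := by
  have hw : (3 : ℝ) ∈ Set.Icc (1 : ℝ) 3 := by norm_num
  have h1 := ellF_wronskian_eq_zero hw
  have h2 := ellF_one_sub_inv_sq hw
  have h3 := ellF_legendre (x := 1 / 9) (by norm_num)
  have h4 := one_le_ellF (x := 8 / 9) (by norm_num) (by norm_num)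
  rw [show (1 - 1 / 3 ^ 2 : ℝ) = 8 / 9 by norm_num,
    show (-(3 - 1) ^ 2 / (4 * 3) : ℝ) = -1 / 3 by norm_num] at h1 h2
  rw [show (1 - 1 / 9 : ℝ) = 8 / 9 by norm_num] at h3
  rw [h2] at h1 h3 h4
  have hs : √3 ^ 2 = (3 : ℝ) := Real.sq_sqrt (by norm_num)
  have hf : ellF (-1 / 3) ≠ 0 := by
    intro h0
    rw [h0] at h4
    norm_num at h4
  have h5 : ellF' (8 / 9) = 9 / 4 * √3 * ellF (-1 / 3) - 3 * √3 * ellF' (-1 / 3) := by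
    refine mul_right_cancel₀ hf ?_
    linear_combination -(9 / 4) * h1
  rw [h5] at h3
  rw [show 18 * √3 / π = 18 * √3 * (1 / π) by ring, ← h3]
  linear_combination
    (-4 * ellF (-1 / 3) * ellF (1 / 9) + 16 / 3 * ellF' (-1 / 3) * ellF (1 / 9)
        - 16 / 9 * ellF (-1 / 3) * ellF' (1 / 9)) * hs

end LegendreSeries

theorem stmt6 :
    Tendsto (fun N => ∑ n ∈ Finset.range N,
      ((2 * n).choose n : ℝ) ^ 2 * legendreP n (1 / 3) * (-1 / 36) ^ n *
        (1 - 3 * (n : ℝ) - 84 * (n : ℝ) ^ 2 - 121 * (n : ℝ) ^ 3))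
      atTop (nhds (18 * Real.sqrt 3 / π)) := by
  have hr := radiusGE_brafmanCoeff
  have hz : |(-4 / 9 : ℝ)| < 1 / 2 := by norm_num [abs_of_neg]
  have h := (((hr.summable hz).hasSum.sub ((hr.euler.summable hz).hasSum.mul_left 3)).sub
    ((hr.euler.euler.summable hz).hasSum.mul_left 84)).sub
    ((hr.euler.euler.euler.summable hz).hasSum.mul_left 121)
  rw [← ellF_combination_eq, ← powerSum_brafmanCoeff_combination]
  refine h.tendsto_sum_nat.congr fun N => Finset.sum_congr rfl fun n _ => ?_
  have e : (-4 / 9 : ℝ) ^ n = 16 ^ n * (-1 / 36) ^ n := by rw [← mul_pow]; norm_num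
  simp only [eulerCoeff, brafmanCoeff, ellCoeff, e]
  field_simp
end

section
/- The series ∑_{n=0}^∞ C(2n,n)² · P_n(1/2) · (3/128)^n · (3 + 14n) converges to 8√2/π. -/
open Real Filter

/-- The homogeneous form `∑ j, C(n,j)² A^(n-j) B^j` of the Legendre polynomial. -/
noncomputable def legendreForm (n : ℕ) (A B : ℂ) : ℂ :=
  ∑ j ∈ Finset.range (n + 1), (n.choose j : ℂ) ^ 2 * A ^ (n - j) * B ^ j

lemma natCast_mul_pow_pred_mul (m : ℕ) (A : ℂ) : (m : ℂ) * A ^ (m - 1) * A = m * A ^ m := by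
  cases m with
  | zero => simp
  | succ k => simp [pow_succ, mul_assoc]

lemma natCast_mul_pow_pred_pred_mul (m : ℕ) (A : ℂ) :
    (m : ℂ) * ((m - 1 : ℕ) * A ^ (m - 1 - 1)) * A = m * (m - 1) * A ^ (m - 1) := by
  cases m with
  | zero => simp
  | succ k =>
    have := natCast_mul_pow_pred_mul k A
    simp only [Nat.add_sub_cancel, Nat.cast_add, Nat.cast_one]
    linear_combination ((k : ℂ) + 1) * this

/-- `(A ∂²/∂A² + ∂/∂A) Q_n = n² Q_{n-1}`. -/
lemma legendreForm_pde_left (n : ℕ) (A B : ℂ) :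
    ∑ j ∈ Finset.range (n + 1), (n.choose j : ℂ) ^ 2 * ((n - j : ℕ) : ℂ) ^ 2 * A ^ (n - j - 1) * B ^ j
      = (n : ℂ) ^ 2 * legendreForm (n - 1) A B := by
  cases n with
  | zero => simp
  | succ m =>
    rw [Finset.sum_range_succ]
    simp only [legendreForm, Nat.sub_self, Nat.cast_zero, Nat.add_sub_cancel, Finset.mul_sum]
    rw [show ((m + 1).choose (m + 1) : ℂ) ^ 2 * (0 : ℂ) ^ 2 * A ^ (0 - 1) * B ^ (m + 1) = 0 by ring,
      add_zero]
    refine Finset.sum_congr rfl fun j hj => ?_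
    have h := congrArg (Nat.cast : ℕ → ℂ) (Nat.choose_mul_succ_eq m j)
    push_cast at h
    have e : m + 1 - j - 1 = m - j := by omega
    rw [e, ← mul_pow, ← h]
    push_cast
    ring

/-- `(B ∂²/∂B² + ∂/∂B) Q_n = n² Q_{n-1}`. -/
lemma legendreForm_pde_right (n : ℕ) (A B : ℂ) :
    ∑ j ∈ Finset.range (n + 1), (n.choose j : ℂ) ^ 2 * (j : ℂ) ^ 2 * A ^ (n - j) * B ^ (j - 1)
      = (n : ℂ) ^ 2 * legendreForm (n - 1) A B := by
  cases n with
  | zero => simp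
  | succ m =>
    rw [Finset.sum_range_succ']
    simp only [legendreForm, Nat.add_sub_cancel, Finset.mul_sum]
    rw [show ((m + 1).choose 0 : ℂ) ^ 2 * ((0 : ℕ) : ℂ) ^ 2 * A ^ (m + 1 - 0) * B ^ (0 - 1) = 0 by
      simp, add_zero]
    refine Finset.sum_congr rfl fun j hj => ?_
    have h := congrArg (Nat.cast : ℕ → ℂ) (Nat.add_one_mul_choose_eq m j)
    push_cast at h
    have e : m + 1 - (j + 1) = m - j := by omega
    rw [e, ← mul_pow]
    push_cast
    rw [← h]
    ring

/-- The polynomial `Y ↦ Q_n(X(1-Y), Y(1-X))`. -/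
noncomputable def bailey (n : ℕ) (X Y : ℂ) : ℂ := legendreForm n (X * (1 - Y)) (Y * (1 - X))

lemma differentiable_bailey (n : ℕ) (X : ℂ) : Differentiable ℂ (bailey n X) := by
  unfold bailey legendreForm
  fun_prop

lemma hasDerivAt_bailey_monomial (X Y : ℂ) (p q : ℕ) :
    HasDerivAt (fun Y => (X * (1 - Y)) ^ p * (Y * (1 - X)) ^ q)
      (-X * (p * (X * (1 - Y)) ^ (p - 1) * (Y * (1 - X)) ^ q)
        + (1 - X) * ((X * (1 - Y)) ^ p * (q * (Y * (1 - X)) ^ (q - 1)))) Y := by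
  have h1 : HasDerivAt (fun Y : ℂ => X * (1 - Y)) (-X) Y := by
    simpa using ((hasDerivAt_id Y).const_sub 1).const_mul X
  have h2 : HasDerivAt (fun Y : ℂ => Y * (1 - X)) (1 - X) Y := by
    simpa using (hasDerivAt_id Y).mul_const (1 - X)
  exact ((h1.fun_pow p).fun_mul (h2.fun_pow q)).congr_deriv (by ring)

lemma deriv_bailey (n : ℕ) (X : ℂ) : deriv (bailey n X) = fun Y =>
    ∑ j ∈ Finset.range (n + 1), (n.choose j : ℂ) ^ 2 *
      (-X * ((n - j : ℕ) * ((X * (1 - Y)) ^ (n - j - 1) * (Y * (1 - X)) ^ j))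
        + (1 - X) * (j * ((X * (1 - Y)) ^ (n - j) * (Y * (1 - X)) ^ (j - 1)))) := by
  funext Y
  refine HasDerivAt.deriv ?_
  unfold bailey legendreForm
  simp only [mul_assoc ((n.choose _ : ℂ) ^ 2)]
  refine HasDerivAt.fun_sum fun j _ => HasDerivAt.const_mul _ ?_
  exact (hasDerivAt_bailey_monomial X Y (n - j) j).congr_deriv (by ring)

lemma deriv_deriv_bailey (n : ℕ) (X Y : ℂ) : deriv (deriv (bailey n X)) Y =
    ∑ j ∈ Finset.range (n + 1), (n.choose j : ℂ) ^ 2 *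
      (-X * ((n - j : ℕ) * (-X * ((n - j - 1 : ℕ) * (X * (1 - Y)) ^ (n - j - 1 - 1) * (Y * (1 - X)) ^ j)
          + (1 - X) * ((X * (1 - Y)) ^ (n - j - 1) * (j * (Y * (1 - X)) ^ (j - 1)))))
        + (1 - X) * (j * (-X * ((n - j : ℕ) * (X * (1 - Y)) ^ (n - j - 1) * (Y * (1 - X)) ^ (j - 1))
          + (1 - X) * ((X * (1 - Y)) ^ (n - j) *
            ((j - 1 : ℕ) * (Y * (1 - X)) ^ (j - 1 - 1)))))) := by
  rw [deriv_bailey]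
  refine HasDerivAt.deriv ?_
  refine HasDerivAt.fun_sum fun j _ => HasDerivAt.const_mul _ ?_
  exact (((hasDerivAt_bailey_monomial X Y (n - j - 1) j).const_mul _).const_mul _).add
    (((hasDerivAt_bailey_monomial X Y (n - j) (j - 1)).const_mul _).const_mul _)

lemma bailey_ode (n : ℕ) (X Y : ℂ) :
    (1 - 2 * Y) * deriv (bailey n X) Y + Y * (1 - Y) * deriv (deriv (bailey n X)) Y
      = (n : ℂ) ^ 2 * bailey (n - 1) X Y - n * (n + 1) * bailey n X Y := by
  have hA := legendreForm_pde_left n (X * (1 - Y)) (Y * (1 - X))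
  have hB := legendreForm_pde_right n (X * (1 - Y)) (Y * (1 - X))
  have key : (1 - 2 * Y) * deriv (bailey n X) Y + Y * (1 - Y) * deriv (deriv (bailey n X)) Y
      = X * ((n : ℂ) ^ 2 * bailey (n - 1) X Y) + (1 - X) * ((n : ℂ) ^ 2 * bailey (n - 1) X Y)
        - n * (n + 1) * bailey n X Y := by
    unfold bailey
    rw [← hA]
    nth_rewrite 2 [hA]
    rw [← hB]
    rw [show deriv (fun Y => legendreForm n (X * (1 - Y)) (Y * (1 - X))) = deriv (bailey n X)
      from rfl, deriv_deriv_bailey, deriv_bailey, legendreForm]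
    simp only [Finset.mul_sum, ← Finset.sum_add_distrib, ← Finset.sum_sub_distrib]
    refine Finset.sum_congr rfl fun j hj => ?_
    obtain ⟨m, rfl⟩ : ∃ m, n = m + j := ⟨n - j, by simp at hj; omega⟩
    simp only [Nat.add_sub_cancel]
    have a1 := natCast_mul_pow_pred_mul m (X * (1 - Y))
    have a2 := natCast_mul_pow_pred_pred_mul m (X * (1 - Y))
    have b1 := natCast_mul_pow_pred_mul j (Y * (1 - X))
    have b2 := natCast_mul_pow_pred_pred_mul j (Y * (1 - X))
    push_cast
    linear_combination ((m + j).choose j : ℂ) ^ 2 * (X * Y * (Y * (1 - X)) ^ j * a2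
      + (1 - X) * (1 - Y) * (X * (1 - Y)) ^ m * b2
      - 2 * (j * (Y * (1 - X)) ^ (j - 1) * (Y * (1 - X)) * a1 + m * (X * (1 - Y)) ^ m * b1)
      - (m + 1) * (Y * (1 - X)) ^ j * a1 - (j + 1) * (X * (1 - Y)) ^ m * b1)
  rw [key]
  ring

/-- The coefficients `C(2n,n)² / 16^n` of `(2/π) K` as a function of the parameter `k²`. -/
noncomputable def ellipticCoeff (n : ℕ) : ℝ := (n.centralBinom : ℝ) ^ 2 / 16 ^ n

lemma ellipticCoeff_pos (n : ℕ) : 0 < ellipticCoeff n := by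
  have : (0 : ℝ) < n.centralBinom := by exact_mod_cast n.centralBinom_pos
  unfold ellipticCoeff
  positivity

lemma ellipticCoeff_le_one (n : ℕ) : ellipticCoeff n ≤ 1 := by
  have h : (n.centralBinom : ℝ) ≤ 4 ^ n := by exact_mod_cast n.centralBinom_le_four_pow
  rw [ellipticCoeff, div_le_one (by positivity)]
  calc (n.centralBinom : ℝ) ^ 2 ≤ (4 ^ n) ^ 2 := by gcongr
    _ = 16 ^ n := by rw [← pow_mul, mul_comm, pow_mul]; norm_num

lemma ellipticCoeff_zero : ellipticCoeff 0 = 1 := by simp [ellipticCoeff]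

lemma ellipticCoeff_succ (n : ℕ) :
    ((n : ℝ) + 1) ^ 2 * ellipticCoeff (n + 1) = (n + 1 / 2) ^ 2 * ellipticCoeff n := by
  have h := congrArg (Nat.cast : ℕ → ℝ) (Nat.succ_mul_centralBinom_succ n)
  push_cast at h
  unfold ellipticCoeff
  rw [← mul_div_assoc, ← mul_pow, h, pow_succ (16 : ℝ)]
  field_simp
  ring

lemma norm_legendreForm_le (n : ℕ) (A B : ℂ) :
    ‖legendreForm n A B‖ ≤ ((√‖A‖ + √‖B‖) ^ 2) ^ n := by
  calc ‖legendreForm n A B‖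
      ≤ ∑ j ∈ Finset.range (n + 1), ‖(n.choose j : ℂ) ^ 2 * A ^ (n - j) * B ^ j‖ :=
        norm_sum_le _ _
    _ = ∑ j ∈ Finset.range (n + 1), (√‖B‖ ^ j * √‖A‖ ^ (n - j) * (n.choose j)) ^ 2 := by
        refine Finset.sum_congr rfl fun j _ => ?_
        rw [mul_pow, mul_pow, ← pow_mul, ← pow_mul, mul_comm j, mul_comm (n - j), pow_mul, pow_mul,
          Real.sq_sqrt (norm_nonneg _), Real.sq_sqrt (norm_nonneg _)]
        simp
        ring
    _ ≤ (∑ j ∈ Finset.range (n + 1), √‖B‖ ^ j * √‖A‖ ^ (n - j) * (n.choose j)) ^ 2 :=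
        Finset.sum_sq_le_sq_sum_of_nonneg fun j _ => by positivity
    _ = ((√‖A‖ + √‖B‖) ^ 2) ^ n := by
        rw [← add_pow, add_comm, ← pow_mul, ← pow_mul, mul_comm]

/-- The radius `√|A| + √|B|` at `A = X(1-Y)`, `B = Y(1-X)`. -/
noncomputable def baileyRadius (X Y : ℂ) : ℝ := √‖X * (1 - Y)‖ + √‖Y * (1 - X)‖

lemma baileyRadius_nonneg (X Y : ℂ) : 0 ≤ baileyRadius X Y := by
  unfold baileyRadius; positivity

lemma continuous_baileyRadius (X : ℂ) : Continuous (baileyRadius X) := by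
  unfold baileyRadius; fun_prop

/-- The series `∑ C(2n,n)²/16^n Q_n(X(1-Y), Y(1-X))`. -/
noncomputable def baileySeries (X Y : ℂ) : ℂ := ∑' n, (ellipticCoeff n : ℂ) * bailey n X Y

lemma norm_ellipticCoeff_mul_bailey_le (n : ℕ) {X Y : ℂ} {r : ℝ} (h : baileyRadius X Y ≤ r) :
    ‖(ellipticCoeff n : ℂ) * bailey n X Y‖ ≤ (r ^ 2) ^ n := by
  rw [norm_mul, Complex.norm_real, Real.norm_of_nonneg (ellipticCoeff_pos n).le]
  have h1 := norm_legendreForm_le n (X * (1 - Y)) (Y * (1 - X))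
  have h2 : ((√‖X * (1 - Y)‖ + √‖Y * (1 - X)‖) ^ 2) ^ n ≤ (r ^ 2) ^ n := by
    have := baileyRadius_nonneg X Y
    unfold baileyRadius at this h
    gcongr
  calc _ ≤ 1 * ‖bailey n X Y‖ := by gcongr; exact ellipticCoeff_le_one n
    _ ≤ _ := by rw [one_mul]; exact h1.trans h2

lemma summable_sq_pow {r : ℝ} (h0 : 0 ≤ r) (h1 : r < 1) : Summable fun n : ℕ => (r ^ 2) ^ n :=
  summable_geometric_of_lt_one (by positivity) (by nlinarith)

lemma hasSum_baileySeries {X Y : ℂ} (h : baileyRadius X Y < 1) :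
    HasSum (fun n => (ellipticCoeff n : ℂ) * bailey n X Y) (baileySeries X Y) :=
  (Summable.of_norm_bounded (summable_sq_pow (baileyRadius_nonneg X Y) h)
    fun n => norm_ellipticCoeff_mul_bailey_le n le_rfl).hasSum

lemma isOpen_baileyRadius_lt (X : ℂ) : IsOpen {Y | baileyRadius X Y < 1} :=
  isOpen_lt (continuous_baileyRadius X) continuous_const

lemma tendstoLocallyUniformlyOn_baileySeries (X : ℂ) :
    TendstoLocallyUniformlyOn
      (fun N Y => ∑ n ∈ Finset.range N, (ellipticCoeff n : ℂ) * bailey n X Y)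
      (baileySeries X) atTop {Y | baileyRadius X Y < 1} := by
  refine tendstoLocallyUniformlyOn_of_forall_exists_nhds fun Y hY => ?_
  obtain ⟨r, hr, hr1⟩ := exists_between (show baileyRadius X Y < 1 from hY)
  refine ⟨{Z | baileyRadius X Z < r}, mem_nhdsWithin_of_mem_nhds
    ((isOpen_lt (continuous_baileyRadius X) continuous_const).mem_nhds hr), ?_⟩
  exact tendstoUniformlyOn_tsum_nat (summable_sq_pow ((baileyRadius_nonneg X Y).trans hr.le) hr1)
    fun n Z hZ => norm_ellipticCoeff_mul_bailey_le n (le_of_lt hZ)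

lemma differentiable_baileySeries_partial (X : ℂ) (N : ℕ) : Differentiable ℂ
    fun Y => ∑ n ∈ Finset.range N, (ellipticCoeff n : ℂ) * bailey n X Y :=
  Differentiable.fun_sum fun n _ => (differentiable_bailey n X).const_mul _

lemma differentiableOn_baileySeries (X : ℂ) :
    DifferentiableOn ℂ (baileySeries X) {Y | baileyRadius X Y < 1} :=
  (tendstoLocallyUniformlyOn_baileySeries X).differentiableOn
    (Eventually.of_forall fun N => (differentiable_baileySeries_partial X N).differentiableOn)
    (isOpen_baileyRadius_lt X)

lemma deriv_baileySeries_partial (X : ℂ) (N : ℕ) :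
    deriv (fun Y => ∑ n ∈ Finset.range N, (ellipticCoeff n : ℂ) * bailey n X Y) =
      fun Y => ∑ n ∈ Finset.range N, (ellipticCoeff n : ℂ) * deriv (bailey n X) Y := by
  funext Y
  exact (HasDerivAt.fun_sum fun n _ =>
    ((differentiable_bailey n X) Y).hasDerivAt.const_mul _).deriv

lemma differentiable_deriv_bailey (n : ℕ) (X : ℂ) : Differentiable ℂ (deriv (bailey n X)) := by
  rw [deriv_bailey]
  fun_prop

lemma deriv_deriv_baileySeries_partial (X : ℂ) (N : ℕ) :
    deriv (deriv fun Y => ∑ n ∈ Finset.range N, (ellipticCoeff n : ℂ) * bailey n X Y) =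
      fun Y => ∑ n ∈ Finset.range N, (ellipticCoeff n : ℂ) * deriv (deriv (bailey n X)) Y := by
  rw [deriv_baileySeries_partial]
  funext Y
  exact (HasDerivAt.fun_sum fun n _ =>
    ((differentiable_deriv_bailey n X) Y).hasDerivAt.const_mul _).deriv

lemma sum_bailey_ode (X Y : ℂ) (N : ℕ) :
    ∑ n ∈ Finset.range (N + 1), (ellipticCoeff n : ℂ) *
        ((n : ℂ) ^ 2 * bailey (n - 1) X Y - n * (n + 1) * bailey n X Y)
      = (∑ n ∈ Finset.range (N + 1), (ellipticCoeff n : ℂ) * bailey n X Y) / 4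
        - ((N : ℂ) + 1 / 2) ^ 2 * (ellipticCoeff N * bailey N X Y) := by
  induction N with
  | zero => simp; ring
  | succ N ih =>
    rw [Finset.sum_range_succ, ih, Finset.sum_range_succ _ (N + 1)]
    have h := congrArg (fun x : ℝ => (x : ℂ)) (ellipticCoeff_succ N)
    push_cast at h ⊢
    linear_combination bailey N X Y * h

lemma tendsto_sq_mul_bailey {X Y : ℂ} (h : baileyRadius X Y < 1) :
    Tendsto (fun N : ℕ => ((N : ℂ) + 1 / 2) ^ 2 * (ellipticCoeff N * bailey N X Y)) atTop
      (nhds 0) := by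
  set r := baileyRadius X Y ^ 2
  have hr0 : 0 ≤ r := by positivity
  have hr1 : r < 1 := by
    have := baileyRadius_nonneg X Y
    nlinarith
  have t2 := tendsto_pow_const_mul_const_pow_of_lt_one 2 hr0 hr1
  have t1 := tendsto_pow_const_mul_const_pow_of_lt_one 1 hr0 hr1
  have t0 := tendsto_pow_const_mul_const_pow_of_lt_one 0 hr0 hr1
  have t := (t2.add t1).add (t0.const_mul (1 / 4))
  refine squeeze_zero_norm (fun N => ?_) (by simpa using t)
  have hb := norm_ellipticCoeff_mul_bailey_le N (le_refl (baileyRadius X Y))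
  have hN : ‖(N : ℂ) + 1 / 2‖ = N + 1 / 2 := by
    rw [show (N : ℂ) + 1 / 2 = ((N + 1 / 2 : ℝ) : ℂ) by push_cast; ring, Complex.norm_real,
      Real.norm_of_nonneg (by positivity)]
  rw [norm_mul, norm_pow, hN]
  calc _ ≤ ((N : ℝ) + 1 / 2) ^ 2 * r ^ N := by gcongr
    _ = _ := by ring

lemma baileySeries_ode {X Y : ℂ} (h : baileyRadius X Y < 1) :
    (1 - 2 * Y) * deriv (baileySeries X) Y + Y * (1 - Y) * deriv (deriv (baileySeries X)) Y
      = baileySeries X Y / 4 := by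
  have hU := isOpen_baileyRadius_lt X
  have hd := differentiable_baileySeries_partial X
  have t0 := tendstoLocallyUniformlyOn_baileySeries X
  have t1 := t0.deriv (Eventually.of_forall fun N => (hd N).differentiableOn) hU
  have hd1 (N : ℕ) : Differentiable ℂ
      (deriv fun Y => ∑ n ∈ Finset.range N, (ellipticCoeff n : ℂ) * bailey n X Y) := by
    rw [deriv_baileySeries_partial]
    exact Differentiable.fun_sum fun n _ => (differentiable_deriv_bailey n X).const_mul _
  have t2 := t1.deriv (Eventually.of_forall fun N => (hd1 N).differentiableOn) hU
  have p0 := t0.tendsto_at h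
  have p1 := t1.tendsto_at h
  have p2 := t2.tendsto_at h
  simp only [Function.comp_def, deriv_deriv_baileySeries_partial] at p2
  simp only [Function.comp_def, deriv_baileySeries_partial] at p1
  have lhs := (tendsto_add_atTop_iff_nat 1).2
    ((p1.const_mul (1 - 2 * Y)).add (p2.const_mul (Y * (1 - Y))))
  have rhs := ((tendsto_add_atTop_iff_nat 1).2 (p0.div_const 4)).sub (tendsto_sq_mul_bailey h)
  rw [sub_zero] at rhs
  refine tendsto_nhds_unique lhs (rhs.congr fun N => ?_)
  rw [← sum_bailey_ode, Finset.mul_sum, Finset.mul_sum, ← Finset.sum_add_distrib]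
  refine Finset.sum_congr rfl fun n _ => ?_
  rw [← bailey_ode]
  ring

/-- The restriction of `baileySeries` to real arguments. -/
noncomputable def realBaileySeries (x y : ℝ) : ℝ := (baileySeries x y).re

lemma hasDerivAt_realBaileySeries {x y : ℝ} (h : baileyRadius x y < 1) :
    HasDerivAt (realBaileySeries x) (deriv (baileySeries x) y).re y :=
  (((differentiableOn_baileySeries x).differentiableAt
    ((isOpen_baileyRadius_lt x).mem_nhds h)).hasDerivAt).real_of_complex

/-- The hypergeometric equation in self-adjoint form. -/
lemma hasDerivAt_realBaileySeries_flux {x y : ℝ} (h : baileyRadius x y < 1) :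
    HasDerivAt (fun y => y * (1 - y) * deriv (realBaileySeries x) y)
      (realBaileySeries x y / 4) y := by
  have hU := isOpen_baileyRadius_lt x
  have hd : HasDerivAt (deriv (baileySeries x)) (deriv (deriv (baileySeries x)) y) y :=
    (((differentiableOn_baileySeries x).deriv hU).differentiableAt (hU.mem_nhds h)).hasDerivAt
  have h1 : HasDerivAt (fun y : ℝ => y * (1 - y)) (1 - 2 * y) y :=
    ((hasDerivAt_id y).fun_mul ((hasDerivAt_id y).const_sub 1)).congr_deriv (by simp; ring)
  have h2 := h1.fun_mul hd.real_of_complex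
  have key := congrArg Complex.re (baileySeries_ode h)
  refine (h2.congr_deriv ?_).congr_of_eventuallyEq ?_
  · rw [realBaileySeries, show (baileySeries x y).re / 4 = (baileySeries x y / 4).re by simp, ← key,
      show (1 - 2 * (y : ℂ)) = ((1 - 2 * y : ℝ) : ℂ) by push_cast; ring,
      show (y : ℂ) * (1 - y) = ((y * (1 - y) : ℝ) : ℂ) by push_cast; ring,
      Complex.add_re, Complex.re_ofReal_mul, Complex.re_ofReal_mul]
  · have : ∀ᶠ z : ℝ in nhds y, baileyRadius x z < 1 :=
      Complex.continuous_ofReal.continuousAt.eventually (hU.mem_nhds h)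
    filter_upwards [this] with z hz
    rw [(hasDerivAt_realBaileySeries hz).deriv]

lemma eq_of_hasDerivAt_zero {F : ℝ → ℝ} {a b : ℝ} (hab : a ≤ b) (hc : ContinuousOn F (Set.Icc a b))
    (hd : ∀ x ∈ Set.Ioo a b, HasDerivAt F 0 x) : F a = F b := by
  rcases hab.eq_or_lt with rfl | h
  · rfl
  obtain ⟨c, -, h2⟩ := exists_hasDerivAt_eq_slope F (fun _ => 0) h hc hd
  have : b - a ≠ 0 := by linarith
  field_simp at h2
  linarith

/-- Termwise differentiation of a real power series. -/
lemma exists_hasSum_hasDerivAt_powerSeries {a : ℕ → ℝ} {r x : ℝ}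
    (hr : Summable fun n => |a n| * r ^ n) (hx : |x| < r) :
    ∃ d, HasSum (fun n : ℕ => a n * (n * x ^ (n - 1))) d ∧
      HasDerivAt (fun x => ∑' n, a n * x ^ n) d x := by
  have hd (n : ℕ) : Differentiable ℂ fun z : ℂ => (a n : ℂ) * z ^ n := by fun_prop
  have hb (n : ℕ) (z : ℂ) (hz : z ∈ Metric.ball (0 : ℂ) r) :
      ‖(a n : ℂ) * z ^ n‖ ≤ |a n| * r ^ n := by
    rw [mem_ball_zero_iff] at hz
    rw [norm_mul, norm_pow, Complex.norm_real, Real.norm_eq_abs]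
    gcongr
  have hxr : (x : ℂ) ∈ Metric.ball (0 : ℂ) r := by simpa using hx
  have h1 := Complex.hasSum_deriv_of_summable_norm hr (fun n => (hd n).differentiableOn)
    Metric.isOpen_ball hb hxr
  have h2 := ((Complex.differentiableOn_tsum_of_summable_norm hr
    (fun n => (hd n).differentiableOn) Metric.isOpen_ball hb).differentiableAt
    (Metric.isOpen_ball.mem_nhds hxr)).hasDerivAt
  refine ⟨_, (Complex.hasSum_re h1).congr_fun fun n => ?_, ?_⟩
  · have h3 : HasDerivAt (fun z : ℂ => (a n : ℂ) * z ^ n) _ x :=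
      (hasDerivAt_pow n (x : ℂ)).const_mul (a n : ℂ)
    rw [h3.deriv]
    norm_cast
  · convert h2.real_of_complex using 2 with y
    rw [← Complex.ofReal_re (∑' n, a n * y ^ n), Complex.ofReal_tsum]
    push_cast
    rfl

/-- Abel summation: if `a n → L`, then `(1 - x) ∑ a n x^n → L` as `x → 1⁻`. -/
lemma tendsto_one_sub_mul_powerSeries {a : ℕ → ℝ} {L : ℝ} (ha : Tendsto a atTop (nhds L))
    (hs : ∀ x ∈ Set.Ioo (0 : ℝ) 1, Summable fun n => a n * x ^ n) :
    Tendsto (fun x => (1 - x) * ∑' n, a n * x ^ n) (nhdsWithin 1 (Set.Iio 1)) (nhds L) := by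
  let b : ℕ → ℝ := fun n => Nat.casesOn n (a 0) fun m => a (m + 1) - a m
  have hb (n : ℕ) : ∑ i ∈ Finset.range (n + 1), b i = a n := by
    induction n with
    | zero => simp [b]
    | succ n ih => rw [Finset.sum_range_succ, ih]; simp [b]
  have ht : Tendsto (fun n => ∑ i ∈ Finset.range n, b i) atTop (nhds L) :=
    (tendsto_add_atTop_iff_nat 1).1 (by simpa only [hb] using ha)
  refine (Real.tendsto_tsum_powerSeries_nhdsWithin_lt ht).congr' ?_
  filter_upwards [Ioo_mem_nhdsLT (show (0 : ℝ) < 1 by norm_num)] with x hx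
  have s := hs x hx
  have s1 := (summable_nat_add_iff 1).2 s
  have e (n : ℕ) : b (n + 1) * x ^ (n + 1) = a (n + 1) * x ^ (n + 1) - x * (a n * x ^ n) := by
    simp only [b]; ring
  have sb : Summable fun n => b n * x ^ n :=
    (summable_nat_add_iff 1).1 (by simpa only [e] using s1.sub (s.mul_left x))
  rw [sb.tsum_eq_zero_add]
  simp only [e]
  rw [s1.tsum_sub (s.mul_left x), tsum_mul_left, show b 0 = a 0 from rfl]
  linear_combination -s.tsum_eq_zero_add

lemma ellipticCoeff_eq_wallis (n : ℕ) :
    ellipticCoeff n = (Real.Wallis.W n)⁻¹ / (2 * n + 1) := by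
  have h := congrArg (Nat.cast : ℕ → ℝ) (Nat.choose_mul_factorial_mul_factorial
    (show n ≤ 2 * n by omega))
  rw [show 2 * n - n = n by omega] at h
  push_cast at h
  rw [Real.Wallis.W_eq_factorial_ratio, ellipticCoeff, Nat.centralBinom, ← h]
  have h1 : (n.factorial : ℝ) ≠ 0 := by positivity
  have h2 : ((2 * n).choose n : ℝ) ≠ 0 := by
    exact_mod_cast (Nat.choose_pos (show n ≤ 2 * n by omega)).ne'
  rw [pow_mul]
  field_simp
  norm_num

lemma tendsto_mul_ellipticCoeff :
    Tendsto (fun n : ℕ => ((n : ℝ) + 1) * ellipticCoeff (n + 1)) atTop (nhds (1 / π)) := by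
  have hW := (Real.Wallis.tendsto_W_nhds_pi_div_two.inv₀ (by positivity)).mul
    (tendsto_natCast_div_add_atTop (1 / 2 : ℝ))
  have h := (hW.div_const 2).comp (tendsto_add_atTop_nat 1)
  rw [show (π / 2)⁻¹ * 1 / 2 = 1 / π by field_simp] at h
  refine h.congr fun n => ?_
  simp only [Function.comp_apply, ellipticCoeff_eq_wallis]
  push_cast
  field_simp

lemma tendsto_ellipticCoeff : Tendsto ellipticCoeff atTop (nhds 0) := by
  refine (tendsto_add_atTop_iff_nat 1).1 ?_
  have h := tendsto_mul_ellipticCoeff.mul (tendsto_one_div_add_atTop_nhds_zero_nat (𝕜 := ℝ))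
  rw [mul_zero] at h
  refine h.congr fun n => ?_
  field_simp

/-- `(2/π) K` as a function of the parameter `t = k²`. -/
noncomputable def ellK (t : ℝ) : ℝ := realBaileySeries 0 t

lemma baileyRadius_zero_lt {t : ℝ} (h : |t| < 1) : baileyRadius ((0 : ℝ) : ℂ) t < 1 := by
  simp only [baileyRadius, Complex.ofReal_zero, zero_mul, norm_zero, Real.sqrt_zero, zero_add,
    sub_zero, mul_one, Complex.norm_real, Real.norm_eq_abs]
  rw [Real.sqrt_lt' one_pos]
  simpa using h

lemma legendreForm_mul (n : ℕ) (z A B : ℂ) :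
    legendreForm n (z * A) (z * B) = z ^ n * legendreForm n A B := by
  unfold legendreForm
  rw [Finset.mul_sum]
  refine Finset.sum_congr rfl fun j hj => ?_
  obtain ⟨m, rfl⟩ : ∃ m, n = m + j := ⟨n - j, by simp at hj; omega⟩
  rw [Nat.add_sub_cancel]
  ring

lemma legendreForm_zero_left (n : ℕ) (B : ℂ) : legendreForm n 0 B = B ^ n := by
  unfold legendreForm
  rw [Finset.sum_range_succ, Finset.sum_eq_zero]
  · simp
  · intro j hj
    rw [zero_pow (by simp at hj; omega)]
    ring

lemma legendreForm_zero_right (n : ℕ) (A : ℂ) : legendreForm n A 0 = A ^ n := by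
  unfold legendreForm
  rw [Finset.sum_range_succ', Finset.sum_eq_zero]
  · simp
  · simp

lemma hasSum_ellK {t : ℝ} (h : |t| < 1) : HasSum (fun n => ellipticCoeff n * t ^ n) (ellK t) := by
  have := Complex.hasSum_re (hasSum_baileySeries (baileyRadius_zero_lt h))
  refine this.congr_fun fun n => ?_
  simp only [bailey, Complex.ofReal_zero, zero_mul, sub_zero, mul_one, legendreForm_zero_left]
  norm_cast

lemma realBaileySeries_zero_right (x : ℝ) : realBaileySeries x 0 = ellK x := by
  simp [realBaileySeries, ellK, baileySeries, bailey, legendreForm_zero_left,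
    legendreForm_zero_right]

lemma ellK_zero : ellK 0 = 1 := by
  refine (hasSum_ellK (by simp)).unique ?_
  convert hasSum_single (f := fun n => ellipticCoeff n * (0 : ℝ) ^ n) 0 ?_ using 1
  · simp [ellipticCoeff_zero]
  · intro n hn
    simp [hn]

lemma one_le_ellK {t : ℝ} (h0 : 0 ≤ t) (h1 : t < 1) : 1 ≤ ellK t := by
  have h := hasSum_ellK (abs_lt.2 ⟨by linarith, h1⟩)
  have := le_hasSum h 0 fun n _ => mul_nonneg (ellipticCoeff_pos n).le (pow_nonneg h0 n)
  simpa [ellipticCoeff_zero] using this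

lemma hasDerivAt_ellK {t : ℝ} (h : |t| < 1) : HasDerivAt ellK (deriv ellK t) t :=
  (hasDerivAt_realBaileySeries (baileyRadius_zero_lt h)).differentiableAt.hasDerivAt

/-- The quantity `t (1 - t) d/dt`, applied to `ellK`. -/
noncomputable def ellFlux (t : ℝ) : ℝ := t * (1 - t) * deriv ellK t

lemma hasDerivAt_ellFlux {t : ℝ} (h : |t| < 1) : HasDerivAt ellFlux (ellK t / 4) t :=
  hasDerivAt_realBaileySeries_flux (baileyRadius_zero_lt h)

lemma continuousAt_deriv_ellK {t : ℝ} (h : |t| < 1) : ContinuousAt (deriv ellK) t := by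
  have hU := isOpen_baileyRadius_lt ((0 : ℝ) : ℂ)
  have hd : ContinuousAt (deriv (baileySeries ((0 : ℝ) : ℂ))) t :=
    (((differentiableOn_baileySeries _).deriv hU).differentiableAt
      (hU.mem_nhds (baileyRadius_zero_lt h))).continuousAt
  refine ((Complex.continuous_re.continuousAt.comp hd).comp
    Complex.continuous_ofReal.continuousAt).congr ?_
  filter_upwards [continuous_abs.continuousAt.eventually_lt_const h] with z hz
  exact (hasDerivAt_realBaileySeries (baileyRadius_zero_lt hz)).deriv.symm

lemma hasSum_deriv_ellK {t : ℝ} (h0 : 0 < t) (h1 : t < 1) :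
    HasSum (fun n : ℕ => (((n : ℝ) + 1) * ellipticCoeff (n + 1)) * t ^ n) (deriv ellK t) := by
  obtain ⟨r, hr, hr1⟩ := exists_between h1
  have hr0 := h0.trans hr
  have hs : Summable fun n => |ellipticCoeff n| * r ^ n := by
    simp only [abs_of_pos (ellipticCoeff_pos _)]
    exact (hasSum_ellK (abs_lt.2 ⟨by linarith, hr1⟩)).summable
  obtain ⟨d, hd, hd'⟩ := exists_hasSum_hasDerivAt_powerSeries hs (abs_lt.2 ⟨by linarith, hr⟩)
  have e : deriv ellK t = d := by
    refine (hd'.congr_of_eventuallyEq ?_).deriv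
    filter_upwards [Ioo_mem_nhds h0 h1] with z hz
    exact (hasSum_ellK (abs_lt.2 ⟨by linarith [hz.1], hz.2⟩)).tsum_eq.symm
  rw [e]
  have h := (hasSum_nat_add_iff' 1).2 hd
  simp only [Finset.range_one, Finset.sum_singleton, Nat.cast_zero, zero_mul, mul_zero,
    sub_zero] at h
  refine h.congr_fun fun n => ?_
  rw [Nat.add_sub_cancel]
  push_cast
  ring

/-- Legendre's relation between complete elliptic integrals. -/
lemma ellFlux_legendre_relation {t : ℝ} (ht : t ∈ Set.Ioo (0 : ℝ) 1) :
    ellFlux t * ellK (1 - t) + ellK t * ellFlux (1 - t) = 1 / π := by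
  let W : ℝ → ℝ := fun t => ellFlux t * ellK (1 - t) + ellK t * ellFlux (1 - t)
  have hW (s : ℝ) (hs : s ∈ Set.Ioo (0 : ℝ) 1) : HasDerivAt W 0 s := by
    have h1 : |s| < 1 := abs_lt.2 ⟨by linarith [hs.1], hs.2⟩
    have h2 : |1 - s| < 1 := abs_lt.2 ⟨by linarith [hs.2], by linarith [hs.1]⟩
    have hK := (hasDerivAt_ellK h2).comp_const_sub 1 s
    have hF := (hasDerivAt_ellFlux h2).comp_const_sub 1 s
    refine (((hasDerivAt_ellFlux h1).fun_mul hK).fun_add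
      ((hasDerivAt_ellK h1).fun_mul hF)).congr_deriv ?_
    unfold ellFlux
    ring
  have hconst (s : ℝ) (hs : s ∈ Set.Ioo (0 : ℝ) 1) : W s = W t :=
    isOpen_Ioo.is_const_of_deriv_eq_zero isPreconnected_Ioo
      (fun x hx => (hW x hx).differentiableAt.differentiableWithinAt)
      (fun x hx => (hW x hx).deriv) hs ht
  have hmem := Ioo_mem_nhdsLT (show (0 : ℝ) < 1 by norm_num)
  have tid : Tendsto (fun s : ℝ => s) (nhdsWithin 1 (Set.Iio 1)) (nhds 1) :=
    tendsto_id.mono_left nhdsWithin_le_nhds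
  have tsub : Tendsto (fun s : ℝ => 1 - s) (nhdsWithin 1 (Set.Iio 1)) (nhds 0) := by
    simpa using tid.const_sub 1
  have tF : Tendsto ellFlux (nhdsWithin 1 (Set.Iio 1)) (nhds (1 / π)) := by
    have h := tid.mul (tendsto_one_sub_mul_powerSeries tendsto_mul_ellipticCoeff
      fun x hx => (hasSum_deriv_ellK hx.1 hx.2).summable)
    rw [one_mul] at h
    refine h.congr' ?_
    filter_upwards [hmem] with x hx
    rw [(hasSum_deriv_ellK hx.1 hx.2).tsum_eq, ellFlux]
    ring
  have tK : Tendsto (fun s => (1 - s) * ellK s) (nhdsWithin 1 (Set.Iio 1)) (nhds 0) := by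
    have habs (x : ℝ) (hx : x ∈ Set.Ioo (0 : ℝ) 1) : |x| < 1 :=
      abs_lt.2 ⟨by linarith [hx.1], hx.2⟩
    refine (tendsto_one_sub_mul_powerSeries tendsto_ellipticCoeff
      fun x hx => (hasSum_ellK (habs x hx)).summable).congr' ?_
    filter_upwards [hmem] with x hx
    rw [(hasSum_ellK (habs x hx)).tsum_eq]
  have tK0 : Tendsto (fun s => ellK (1 - s)) (nhdsWithin 1 (Set.Iio 1)) (nhds 1) := by
    have h := (hasDerivAt_ellK (t := 0) (by simp)).continuousAt.tendsto.comp tsub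
    rwa [ellK_zero] at h
  have tK1 : Tendsto (fun s => deriv ellK (1 - s)) (nhdsWithin 1 (Set.Iio 1))
      (nhds (deriv ellK 0)) :=
    (continuousAt_deriv_ellK (by simp)).tendsto.comp tsub
  have tW : Tendsto W (nhdsWithin 1 (Set.Iio 1)) (nhds (1 / π)) := by
    have h := (tF.mul tK0).add ((tK.mul tid).mul tK1)
    rw [mul_one, zero_mul, zero_mul, add_zero] at h
    refine h.congr fun s => ?_
    simp only [W, ellFlux]
    ring
  refine tendsto_nhds_unique (tendsto_const_nhds.congr' ?_) tW
  filter_upwards [hmem] with s hs using (hconst s hs).symm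

/-- The argument `-(1-l)²/(4l)` in Landen's transformation. -/
noncomputable def landenArg (l : ℝ) : ℝ := -(1 - l) ^ 2 / (4 * l)

lemma abs_landenArg_lt {l : ℝ} (hl : l ∈ Set.Ioo (3 / 10 : ℝ) (11 / 10)) : |landenArg l| < 1 := by
  have h0 : 0 < l := by linarith [hl.1]
  have h1 := hl.1
  have h2 := hl.2
  rw [landenArg, abs_div, abs_neg, abs_of_nonneg (sq_nonneg _), abs_of_pos (by linarith),
    div_lt_one (by linarith)]
  nlinarith

lemma abs_one_sub_sq_lt {l : ℝ} (hl : l ∈ Set.Ioo (3 / 10 : ℝ) (11 / 10)) : |1 - l ^ 2| < 1 := by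
  have h1 := hl.1
  have h2 := hl.2
  rw [abs_lt]
  constructor <;> nlinarith

lemma hasDerivAt_landenArg {l : ℝ} (hl : l ≠ 0) :
    HasDerivAt landenArg ((1 - l ^ 2) / (4 * l ^ 2)) l := by
  have h1 : HasDerivAt (fun l : ℝ => -(1 - l) ^ 2) (2 * (1 - l)) l :=
    (((hasDerivAt_id l).const_sub 1).fun_pow 2).fun_neg.congr_deriv (by simp)
  have h2 : HasDerivAt (fun l : ℝ => 4 * l) 4 l := by simpa using (hasDerivAt_id l).const_mul 4
  refine (h1.fun_div h2 (by simpa using hl)).congr_deriv ?_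
  field_simp
  ring

lemma hasDerivAt_ellK_landenArg {l : ℝ} (hl : l ∈ Set.Ioo (3 / 10 : ℝ) (11 / 10)) :
    HasDerivAt (fun l => ellK (landenArg l))
      (deriv ellK (landenArg l) * ((1 - l ^ 2) / (4 * l ^ 2))) l :=
  (hasDerivAt_ellK (abs_landenArg_lt hl)).comp l
    (hasDerivAt_landenArg (by linarith [hl.1] : (0 : ℝ) < l).ne')

lemma hasDerivAt_ellFlux_landenArg {l : ℝ} (hl : l ∈ Set.Ioo (3 / 10 : ℝ) (11 / 10)) :
    HasDerivAt (fun l => ellFlux (landenArg l))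
      (ellK (landenArg l) / 4 * ((1 - l ^ 2) / (4 * l ^ 2))) l :=
  (hasDerivAt_ellFlux (abs_landenArg_lt hl)).comp l
    (hasDerivAt_landenArg (by linarith [hl.1] : (0 : ℝ) < l).ne')

lemma hasDerivAt_one_sub_sq (l : ℝ) : HasDerivAt (fun l : ℝ => 1 - l ^ 2) (-(2 * l)) l := by
  simpa using (hasDerivAt_pow 2 l).const_sub 1

lemma hasDerivAt_sqrt_mul_ellK {l : ℝ} (hl : l ∈ Set.Ioo (3 / 10 : ℝ) (11 / 10)) :
    HasDerivAt (fun l => √l * ellK (1 - l ^ 2))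
      (1 / (2 * √l) * ellK (1 - l ^ 2) + √l * (deriv ellK (1 - l ^ 2) * -(2 * l))) l :=
  (Real.hasDerivAt_sqrt (by linarith [hl.1] : (0 : ℝ) < l).ne').fun_mul
    ((hasDerivAt_ellK (abs_one_sub_sq_lt hl)).comp l (hasDerivAt_one_sub_sq l))

/-- The function `(1 - l²) d/dl (√l ellK (1 - l²))`. -/
noncomputable def landenFlux (l : ℝ) : ℝ :=
  ((1 - l ^ 2) / 2 * ellK (1 - l ^ 2) - 2 * ellFlux (1 - l ^ 2)) / √l

lemma hasDerivAt_landenFlux {l : ℝ} (hl : l ∈ Set.Ioo (3 / 10 : ℝ) (11 / 10)) :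
    HasDerivAt landenFlux (-(√l * ellK (1 - l ^ 2)) * ((1 - l ^ 2) / (4 * l ^ 2))) l := by
  have h0 : 0 < l := by linarith [hl.1]
  have hK := (hasDerivAt_ellK (abs_one_sub_sq_lt hl)).comp l (hasDerivAt_one_sub_sq l)
  have hF := (hasDerivAt_ellFlux (abs_one_sub_sq_lt hl)).comp l (hasDerivAt_one_sub_sq l)
  have hs : 0 < √l := Real.sqrt_pos.2 h0
  refine (((((hasDerivAt_one_sub_sq l).div_const 2).fun_mul hK).fun_sub
    (hF.const_mul 2)).fun_div (Real.hasDerivAt_sqrt h0.ne') hs.ne').congr_deriv ?_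
  simp only [Function.comp_apply]
  have e : √l ^ 2 = l := Real.sq_sqrt h0.le
  obtain ⟨s, hs', rfl⟩ : ∃ s, 0 < s ∧ l = s ^ 2 := ⟨√l, hs, e.symm⟩
  rw [Real.sqrt_sq hs'.le, ellFlux]
  field_simp
  ring

lemma one_sub_sq_mul_deriv_landen {l k d : ℝ} (h0 : 0 < l) (hd : deriv ellK (1 - l ^ 2) = d)
    (hk : ellK (1 - l ^ 2) = k) :
    (1 - l ^ 2) * (1 / (2 * √l) * k + √l * (d * -(2 * l))) = landenFlux l := by
  rw [landenFlux, ellFlux, hd, hk]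
  have e : √l ^ 2 = l := Real.sq_sqrt h0.le
  obtain ⟨s, hs', rfl⟩ : ∃ s, 0 < s ∧ l = s ^ 2 := ⟨√l, Real.sqrt_pos.2 h0, e.symm⟩
  rw [Real.sqrt_sq hs'.le]
  field_simp
  ring

lemma one_sub_sq_mul_deriv_landenArg {l : ℝ} (h0 : 0 < l) :
    (1 - l ^ 2) * (deriv ellK (landenArg l) * ((1 - l ^ 2) / (4 * l ^ 2)))
      = -4 * ellFlux (landenArg l) := by
  rw [ellFlux]
  generalize deriv ellK (landenArg l) = d
  rw [landenArg]
  field_simp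
  ring

lemma landen_wronskian {l : ℝ} (hl : l ∈ Set.Ioo (3 / 10 : ℝ) (11 / 10)) :
    ellK (landenArg l) * landenFlux l
      + 4 * ellFlux (landenArg l) * (√l * ellK (1 - l ^ 2)) = 0 := by
  let w : ℝ → ℝ := fun l => ellK (landenArg l) * landenFlux l
      + 4 * ellFlux (landenArg l) * (√l * ellK (1 - l ^ 2))
  have hw (l : ℝ) (hl : l ∈ Set.Ioo (3 / 10 : ℝ) (11 / 10)) : HasDerivAt w 0 l := by
    have h0 : 0 < l := by linarith [hl.1]
    refine (((hasDerivAt_ellK_landenArg hl).fun_mul (hasDerivAt_landenFlux hl)).fun_add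
      (((hasDerivAt_ellFlux_landenArg hl).const_mul 4).fun_mul
        (hasDerivAt_sqrt_mul_ellK hl))).congr_deriv ?_
    rw [← one_sub_sq_mul_deriv_landen h0 rfl rfl]
    linear_combination -(1 / (2 * √l) * ellK (1 - l ^ 2)
      + √l * (deriv ellK (1 - l ^ 2) * -(2 * l))) * -one_sub_sq_mul_deriv_landenArg h0
  have := isOpen_Ioo.is_const_of_deriv_eq_zero isPreconnected_Ioo
      (fun x hx => (hw x hx).differentiableAt.differentiableWithinAt)
      (fun x hx => (hw x hx).deriv) hl (show (1 : ℝ) ∈ Set.Ioo (3 / 10 : ℝ) (11 / 10) by norm_num)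
  simp only [w] at this
  rw [this]
  simp [landenFlux, landenArg, ellFlux]

/-- Landen's transformation. -/
lemma ellK_landenArg {l : ℝ} (hl : l ∈ Set.Ioo (3 / 10 : ℝ) 1) :
    ellK (landenArg l) = √l * ellK (1 - l ^ 2) := by
  have hsub (x : ℝ) (hx : x ∈ Set.Icc l 1) : x ∈ Set.Ioo (3 / 10 : ℝ) (11 / 10) :=
    ⟨by linarith [hx.1, hl.1], by linarith [hx.2]⟩
  have hpos (x : ℝ) (hx : x ∈ Set.Icc l 1) : 0 < √x * ellK (1 - x ^ 2) := by
    have h0 : 0 < x := by linarith [hl.1, hx.1]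
    have h1 := one_le_ellK (t := 1 - x ^ 2) (by nlinarith [hx.2]) (by nlinarith)
    have := Real.sqrt_pos.2 h0
    positivity
  have hd (x : ℝ) (hx : x ∈ Set.Icc l 1) := (hasDerivAt_ellK_landenArg (hsub x hx)).fun_div
    (hasDerivAt_sqrt_mul_ellK (hsub x hx)) (hpos x hx).ne'
  have key := eq_of_hasDerivAt_zero
    (F := fun l => ellK (landenArg l) / (√l * ellK (1 - l ^ 2))) hl.2.le
    (fun x hx => (hd x hx).continuousAt.continuousWithinAt) fun x hx => by
      have hx' := Set.Ioo_subset_Icc_self hx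
      have h0 : 0 < x := by linarith [hl.1, hx.1]
      refine (hd x hx').congr_deriv ?_
      rw [div_eq_zero_iff]
      left
      have h1 : 1 - x ^ 2 ≠ 0 := by nlinarith [hx.2]
      apply mul_left_cancel₀ h1
      have hw := landen_wronskian (hsub x hx')
      rw [← one_sub_sq_mul_deriv_landen h0 rfl rfl] at hw
      linear_combination √x * ellK (1 - x ^ 2) * one_sub_sq_mul_deriv_landenArg h0 - hw
  have h1 : ellK (landenArg 1) / (√1 * ellK (1 - 1 ^ 2)) = 1 := by
    simp [landenArg, ellK_zero]
  simp only [h1] at key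
  rwa [div_eq_one_iff_eq (hpos l ⟨le_rfl, hl.2.le⟩).ne'] at key

lemma ellK_neg_eighth : ellK (-1 / 8) = √(1 / 2) * ellK (3 / 4) := by
  have h := ellK_landenArg (l := 1 / 2) (by norm_num)
  norm_num [landenArg] at h ⊢
  exact h

lemma deriv_ellK_neg_eighth :
    3 / 4 * deriv ellK (-1 / 8) = √(1 / 2) * (ellK (3 / 4) - deriv ellK (3 / 4)) := by
  have hm : (1 / 2 : ℝ) ∈ Set.Ioo (3 / 10 : ℝ) (11 / 10) := by norm_num
  have h1 := hasDerivAt_ellK_landenArg hm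
  have h2 := (hasDerivAt_sqrt_mul_ellK hm).congr_of_eventuallyEq
    (f₁ := fun l => ellK (landenArg l)) (by
      filter_upwards [Ioo_mem_nhds (show (3 / 10 : ℝ) < 1 / 2 by norm_num)
        (show (1 / 2 : ℝ) < 1 by norm_num)] with x hx using ellK_landenArg hx)
  have h := h1.unique h2
  rw [show landenArg (1 / 2) = -1 / 8 by norm_num [landenArg],
    show (1 : ℝ) - (1 / 2) ^ 2 = 3 / 4 by norm_num] at h
  have hs : √(1 / 2 : ℝ) ^ 2 = 1 / 2 := Real.sq_sqrt (by norm_num)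
  have hs0 : 0 < √(1 / 2 : ℝ) := Real.sqrt_pos.2 (by norm_num)
  have e : 1 / (2 * √(1 / 2 : ℝ)) = √(1 / 2) := by
    rw [div_eq_iff (by positivity)]
    linarith
  rw [e] at h
  linarith

lemma baileyRadius_lt_one {x y : ℝ} (hx : |x| < 1 / 7) (hy : |y| < 2 / 7) :
    baileyRadius x y < 1 := by
  have hx' : |1 - x| ≤ 1 + |x| := by simpa using abs_sub (1 : ℝ) x
  have hy' : |1 - y| ≤ 1 + |y| := by simpa using abs_sub (1 : ℝ) y
  have h1 : √‖(x : ℂ) * (1 - y)‖ < 3 / 7 := by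
    rw [Real.sqrt_lt' (by norm_num)]
    norm_cast
    rw [norm_mul, Real.norm_eq_abs, Real.norm_eq_abs]
    nlinarith [abs_nonneg x, abs_nonneg y, abs_nonneg (1 - y)]
  have h2 : √‖(y : ℂ) * (1 - x)‖ < 4 / 7 := by
    rw [Real.sqrt_lt' (by norm_num)]
    norm_cast
    rw [norm_mul, Real.norm_eq_abs, Real.norm_eq_abs]
    nlinarith [abs_nonneg x, abs_nonneg y, abs_nonneg (1 - x)]
  unfold baileyRadius
  linarith

/-- Bailey's factorisation of the Appell series. -/
lemma realBaileySeries_eq_mul {x y : ℝ} (hx : |x| < 1 / 7) (hy : y ∈ Set.Ico (0 : ℝ) (2 / 7)) :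
    realBaileySeries x y = ellK x * ellK y := by
  have hg (s : ℝ) (hs : s ∈ Set.Ioo (-(2 / 7) : ℝ) (2 / 7)) :
      HasDerivAt (realBaileySeries x) (deriv (realBaileySeries x) s) s :=
    (hasDerivAt_realBaileySeries
      (baileyRadius_lt_one hx (abs_lt.2 hs))).differentiableAt.hasDerivAt
  have hgF (s : ℝ) (hs : s ∈ Set.Ioo (-(2 / 7) : ℝ) (2 / 7)) :=
    hasDerivAt_realBaileySeries_flux (baileyRadius_lt_one hx (abs_lt.2 hs))
  have habs (s : ℝ) (hs : s ∈ Set.Ioo (-(2 / 7) : ℝ) (2 / 7)) : |s| < 1 :=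
    (abs_lt.2 hs).trans (by norm_num)
  have hsub (s : ℝ) (hs : s ∈ Set.Icc 0 y) : s ∈ Set.Ioo (-(2 / 7) : ℝ) (2 / 7) :=
    ⟨by linarith [hs.1], by linarith [hs.2, hy.2]⟩
  have hpos (s : ℝ) (hs : s ∈ Set.Icc 0 y) : 0 < ellK s :=
    one_pos.trans_le (one_le_ellK hs.1 (by linarith [hs.2, hy.2]))
  let w : ℝ → ℝ := fun s => s * (1 - s) * deriv (realBaileySeries x) s * ellK s
    - realBaileySeries x s * ellFlux s
  have hw (s : ℝ) (hs : s ∈ Set.Ioo (-(2 / 7) : ℝ) (2 / 7)) : HasDerivAt w 0 s := by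
    refine (((hgF s hs).fun_mul (hasDerivAt_ellK (habs s hs))).fun_sub
      ((hg s hs).fun_mul (hasDerivAt_ellFlux (habs s hs)))).congr_deriv ?_
    unfold ellFlux
    ring
  have hw0 (s : ℝ) (hs : s ∈ Set.Ioo (-(2 / 7) : ℝ) (2 / 7)) : w s = 0 := by
    rw [isOpen_Ioo.is_const_of_deriv_eq_zero isPreconnected_Ioo
      (fun x hx => (hw x hx).differentiableAt.differentiableWithinAt)
      (fun x hx => (hw x hx).deriv) hs
      (show (0 : ℝ) ∈ Set.Ioo (-(2 / 7) : ℝ) (2 / 7) by norm_num)]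
    simp [w, ellFlux]
  have hd (s : ℝ) (hs : s ∈ Set.Icc 0 y) :=
    (hg s (hsub s hs)).fun_div (hasDerivAt_ellK (habs s (hsub s hs))) (hpos s hs).ne'
  have key := eq_of_hasDerivAt_zero (F := fun s => realBaileySeries x s / ellK s) hy.1
    (fun s hs => (hd s hs).continuousAt.continuousWithinAt) fun s hs => by
      have hs' := Set.Ioo_subset_Icc_self hs
      refine (hd s hs').congr_deriv ?_
      rw [div_eq_zero_iff]
      left
      have h1 : s * (1 - s) ≠ 0 := mul_ne_zero hs.1.ne' (by linarith [hs.2, hy.2])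
      apply mul_left_cancel₀ h1
      have := hw0 s (hsub s hs')
      simp only [w, ellFlux] at this
      linear_combination this
  simp only [realBaileySeries_zero_right, ellK_zero, div_one] at key
  rw [key, div_mul_cancel₀ _ (hpos y ⟨hy.1, le_rfl⟩).ne']

lemma legendreForm_eq_legendreP (n : ℕ) :
    legendreForm n (-(1 / 4)) (3 / 4) = (legendreP n (1 / 2) : ℂ) := by
  have h := legendreForm_mul n (2⁻¹) (-(1 / 2)) (3 / 2)
  norm_num at h ⊢
  rw [h, legendreForm, legendreP]
  push_cast
  norm_num

lemma summable_ellipticCoeff_mul_legendreP :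
    Summable fun n => |ellipticCoeff n * legendreP n (1 / 2)| * (1 / 2 : ℝ) ^ n := by
  have h1 : √(1 / 8 : ℝ) < 36 / 100 := (Real.sqrt_lt' (by norm_num)).2 (by norm_num)
  have h2 : √(3 / 8 : ℝ) < 62 / 100 := (Real.sqrt_lt' (by norm_num)).2 (by norm_num)
  refine Summable.of_nonneg_of_le (fun n => by positivity) (fun n => ?_)
    (summable_sq_pow (r := √(1 / 8) + √(3 / 8)) (by positivity) (by linarith))
  have h := norm_legendreForm_le n ((1 / 2 : ℂ) * -(1 / 4)) ((1 / 2 : ℂ) * (3 / 4))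
  rw [legendreForm_mul, legendreForm_eq_legendreP, norm_mul, norm_pow, Complex.norm_real,
    Real.norm_eq_abs] at h
  norm_num at h
  rw [abs_mul, abs_of_pos (ellipticCoeff_pos n)]
  have h3 := ellipticCoeff_le_one n
  calc _ ≤ 1 * |legendreP n (1 / 2)| * (1 / 2 : ℝ) ^ n := by gcongr
    _ = (1 / 2 : ℝ) ^ n * |legendreP n (1 / 2)| := by ring
    _ ≤ _ := by norm_num; exact h

/-- The first argument in the factorisation of the generating function at `x = 1/2`. -/
noncomputable def brafmanLeft (z : ℝ) : ℝ := (1 - √(1 - z + z ^ 2) - z) / 2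

/-- The second argument in the factorisation of the generating function at `x = 1/2`. -/
noncomputable def brafmanRight (z : ℝ) : ℝ := (1 - √(1 - z + z ^ 2) + z) / 2

lemma sqrt_brafman : √(1 - 3 / 8 + (3 / 8) ^ 2 : ℝ) = 7 / 8 := by
  rw [Real.sqrt_eq_iff_mul_self_eq (by norm_num) (by norm_num)]
  norm_num

lemma brafmanLeft_value : brafmanLeft (3 / 8) = -1 / 8 := by
  rw [brafmanLeft, sqrt_brafman]
  norm_num

lemma brafmanRight_value : brafmanRight (3 / 8) = 1 / 4 := by
  rw [brafmanRight, sqrt_brafman]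
  norm_num

lemma hasDerivAt_sqrt_brafman :
    HasDerivAt (fun z : ℝ => √(1 - z + z ^ 2)) (-1 / 7) (3 / 8) := by
  have h : HasDerivAt (fun z : ℝ => 1 - z + z ^ 2) (-1 / 4) (3 / 8) :=
    (((hasDerivAt_id (3 / 8 : ℝ)).const_sub 1).fun_add (hasDerivAt_pow 2 (3 / 8))).congr_deriv
      (by norm_num)
  refine (h.sqrt (by norm_num)).congr_deriv ?_
  rw [sqrt_brafman]
  norm_num

lemma hasDerivAt_brafmanLeft : HasDerivAt brafmanLeft (-3 / 7) (3 / 8) :=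
  (((hasDerivAt_sqrt_brafman.const_sub 1).fun_sub (hasDerivAt_id _)).div_const 2).congr_deriv
    (by norm_num)

lemma hasDerivAt_brafmanRight : HasDerivAt brafmanRight (4 / 7) (3 / 8) :=
  (((hasDerivAt_sqrt_brafman.const_sub 1).fun_add (hasDerivAt_id _)).div_const 2).congr_deriv
    (by norm_num)

lemma bailey_brafman (n : ℕ) (z : ℝ) :
    bailey n (brafmanLeft z) (brafmanRight z) = (z : ℂ) ^ n * legendreP n (1 / 2) := by
  have hs : √(1 - z + z ^ 2) ^ 2 = 1 - z + z ^ 2 := Real.sq_sqrt (by nlinarith [sq_nonneg (z - 1)])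
  have h1 : brafmanLeft z * (1 - brafmanRight z) = z * -(1 / 4) := by
    unfold brafmanLeft brafmanRight
    linear_combination -hs / 4
  have h2 : brafmanRight z * (1 - brafmanLeft z) = z * (3 / 4) := by
    unfold brafmanLeft brafmanRight
    linear_combination -hs / 4
  have h1' := congrArg (fun x : ℝ => (x : ℂ)) h1
  have h2' := congrArg (fun x : ℝ => (x : ℂ)) h2
  push_cast at h1' h2'
  rw [bailey, h1', h2', legendreForm_mul, legendreForm_eq_legendreP]

/-- Brafman's formula at `x = 1/2`. -/
lemma hasSum_brafman {z : ℝ} (hX : |brafmanLeft z| < 1 / 7)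
    (hY : brafmanRight z ∈ Set.Ico (0 : ℝ) (2 / 7)) :
    HasSum (fun n => ellipticCoeff n * legendreP n (1 / 2) * z ^ n)
      (ellK (brafmanLeft z) * ellK (brafmanRight z)) := by
  rw [← realBaileySeries_eq_mul hX hY]
  refine (Complex.hasSum_re (hasSum_baileySeries (baileyRadius_lt_one hX
    (abs_lt.2 ⟨by linarith [hY.1], hY.2⟩)))).congr_fun fun n => ?_
  rw [bailey_brafman]
  norm_cast
  ring

theorem stmt7 :
    Tendsto (fun N => ∑ n ∈ Finset.range N,
      ((2 * n).choose n : ℝ) ^ 2 * legendreP n (1 / 2) * (3 / 128) ^ n * (3 + 14 * (n : ℝ)))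
      atTop (nhds (8 * Real.sqrt 2 / π)) := by
  have hX := hasDerivAt_brafmanLeft
  have hY := hasDerivAt_brafmanRight
  have eX : ∀ᶠ z in nhds (3 / 8), |brafmanLeft z| < 1 / 7 :=
    hX.continuousAt.abs.eventually_lt_const (by
      change |brafmanLeft (3 / 8)| < 1 / 7
      rw [brafmanLeft_value]
      norm_num [abs_lt])
  have eY : ∀ᶠ z in nhds (3 / 8), brafmanRight z ∈ Set.Ico (0 : ℝ) (2 / 7) :=
    hY.continuousAt.eventually (by
      rw [brafmanRight_value]
      exact Ico_mem_nhds (by norm_num) (by norm_num))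
  have hsum := hasSum_brafman eX.self_of_nhds eY.self_of_nhds
  obtain ⟨d, hd, hd'⟩ := exists_hasSum_hasDerivAt_powerSeries (x := 3 / 8)
    summable_ellipticCoeff_mul_legendreP (by norm_num [abs_lt])
  have hprod := (HasDerivAt.comp (h₂ := ellK) (3 / 8 : ℝ)
      (hasDerivAt_ellK (by rw [brafmanLeft_value]; norm_num [abs_lt])) hX).fun_mul
    (HasDerivAt.comp (h₂ := ellK) (3 / 8 : ℝ)
      (hasDerivAt_ellK (by rw [brafmanRight_value]; norm_num [abs_lt])) hY)
  have hdval := hprod.unique (hd'.congr_of_eventuallyEq (by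
    filter_upwards [eX, eY] with z h1 h2 using (hasSum_brafman h1 h2).tsum_eq.symm))
  simp only [Function.comp_apply, brafmanLeft_value, brafmanRight_value] at hdval hsum
  have htotal := (hsum.mul_left 3).add (hd.mul_left (14 * (3 / 8)))
  have hval : 3 * (ellK (-1 / 8) * ellK (1 / 4)) + 14 * (3 / 8) * d = 8 * √2 / π := by
    have hL := ellFlux_legendre_relation (t := 1 / 4) (by norm_num)
    rw [show (1 : ℝ) - 1 / 4 = 3 / 4 by norm_num, ellFlux, ellFlux] at hL
    have hs : √2 = 2 * √(1 / 2 : ℝ) := by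
      rw [Real.sqrt_eq_iff_mul_self_eq (by norm_num) (by positivity)]
      have := Real.mul_self_sqrt (show (0 : ℝ) ≤ 1 / 2 by norm_num)
      linarith
    rw [← hdval, ellK_neg_eighth, hs, div_eq_mul_one_div _ π, ← hL]
    linear_combination -3 * ellK (1 / 4) * deriv_ellK_neg_eighth
  rw [hval] at htotal
  refine (htotal.congr_fun fun n => ?_).tendsto_sum_nat
  have e : (n : ℝ) * (3 / 8 : ℝ) ^ (n - 1) * (3 / 8) = n * (3 / 8) ^ n := by
    cases n with
    | zero => simp
    | succ k => rw [Nat.add_sub_cancel]; ring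
  have e2 : (3 / 128 : ℝ) ^ n = (3 / 8) ^ n / 16 ^ n := by
    rw [← div_pow]; norm_num
  rw [e2, ellipticCoeff, Nat.centralBinom]
  linear_combination -14 * (((2 * n).choose n : ℝ) ^ 2 / 16 ^ n) * legendreP n (1 / 2) * e
end
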